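/- arXiv:1205.6387 — 5 statements merged into one kernel-verified Lean document; each statement's English description precedes it below -/
import Mathlib

section
/- If n ≥ 2, then the orbit space X_z of any linear torus action on the sphere S^{2n−1} given by a weight matrix z is simply connected. -/
open scoped BigOperators

noncomputable section

/-- The sphere `S^{2n-1}`, realized as the unit sphere of `ℂ^n`. -/
abbrev Sph (n : ℕ) : Type := Metric.sphere (0 : EuclideanSpace ℂ (Fin n)) 1

/-- The element of the circle by which `t ∈ T^r = (Fin r → Circle)` acts on the `j`-th
coordinate of `ℂ^n`, namely `∏ i, (t i) ^ (z i j)`. -/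
def weightProd {n r : ℕ} (z : Fin r → Fin n → ℤ) (t : Fin r → Circle) (j : Fin n) : Circle :=
  ∏ i, t i ^ z i j

/-- The orbit equivalence relation on `S^{2n-1}` for the linear torus action with weight
matrix `z`:  `x ≈ y` iff some `t ∈ T^r` moves `x` to `y`, where `(t • x) j = (∏ i, (t i)^(z i j)) • (x j)`. -/
def orbitSetoid {n r : ℕ} (z : Fin r → Fin n → ℤ) : Setoid (Sph n) where
  r x y := ∃ t : Fin r → Circle,
    ∀ j, (weightProd z t j : ℂ) * (x : EuclideanSpace ℂ (Fin n)) j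
      = (y : EuclideanSpace ℂ (Fin n)) j
  iseqv := by
    constructor
    · intro x
      exact ⟨1, fun j => by simp [weightProd]⟩
    · rintro x y ⟨t, ht⟩
      refine ⟨fun i => (t i)⁻¹, fun j => ?_⟩
      have h : weightProd z (fun i => (t i)⁻¹) j = (weightProd z t j)⁻¹ := by
        simp only [weightProd, inv_zpow]
        exact Finset.prod_inv_distrib _
      rw [h, ← ht j, Circle.coe_inv, inv_mul_cancel_left₀ (Circle.coe_ne_zero _)]
    · rintro x y zz ⟨t, ht⟩ ⟨s, hs⟩
      refine ⟨t * s, fun j => ?_⟩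
      have h : weightProd z (t * s) j = weightProd z t j * weightProd z s j := by
        simp [weightProd, mul_zpow, Finset.prod_mul_distrib]
      rw [h, ← hs j, ← ht j]
      push_cast
      ring

/-- The orbit space `X_z = S^{2n-1}/T^r` of the linear torus action with weight matrix `z`,
equipped with the quotient topology. -/
abbrev OrbitSpace {n r : ℕ} (z : Fin r → Fin n → ℤ) : Type := Quotient (orbitSetoid z)

open Set unitInterval Topology

theorem aux_paths_homotopic {X : Type*} [TopologicalSpace X] {ι : Type*} (A : ι → Set X)
    (ho : ∀ i, IsOpen (A i)) (hc : ∀ x, ∃ i, x ∈ A i) (x0 : X) (h0 : ∀ i, x0 ∈ A i)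
    (hpc : ∀ i j, IsPathConnected (A i ∩ A j))
    (h : ∀ i (a b : X) (p q : Path a b), (∀ t, p t ∈ A i) → (∀ t, q t ∈ A i) → p.Homotopic q)
    {y : X} (γ : Path x0 y) (j : ι) (δ : Path x0 y) (hδ : ∀ t, δ t ∈ A j) : γ.Homotopic δ := by
  obtain ⟨t, t0, tm, ⟨N, hN⟩, ht⟩ := exists_monotone_Icc_subset_open_cover_unitInterval
    (c := fun i => γ ⁻¹' A i) (fun i => (ho i).preimage γ.continuous)
    (fun s _ => by obtain ⟨i, hi⟩ := hc (γ s); exact mem_iUnion.2 ⟨i, hi⟩)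
  have key : ∀ m, ∀ j, ∀ δ : Path x0 (γ (t m)), (∀ s, δ s ∈ A j) →
      ((γ.subpath 0 (t m)).cast γ.source.symm rfl).Homotopic δ := by
    intro m
    induction m with
    | zero =>
      intro j δ hδ
      apply h j _ _ _ _ _ hδ
      intro s
      change γ (Icc.convexComb 0 (t 0) s) ∈ A j
      rw [t0, Icc.convexComb_eq]
      simpa using h0 j
    | succ m ih =>
      intro j δ hδ
      obtain ⟨i, hi⟩ := ht m
      have hm : t m ≤ t (m+1) := tm (Nat.le_succ m)
      have hsub : ∀ s, γ.subpath (t m) (t (m+1)) s ∈ A i := by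
        intro s
        have : γ.subpath (t m) (t (m+1)) s ∈ range (γ.subpath (t m) (t (m+1))) := ⟨s, rfl⟩
        rw [Path.range_subpath_of_le _ _ _ hm] at this
        obtain ⟨u, hu, hu'⟩ := this
        rw [← hu']
        exact hi hu
      have e1 : γ (t m) ∈ A i := hi ⟨le_rfl, hm⟩
      have e2 : γ (t (m+1)) ∈ A i := hi ⟨hm, le_rfl⟩
      have e3 : γ (t (m+1)) ∈ A j := by simpa using hδ 1
      have jη := (hpc i i).joinedIn x0 ⟨h0 i, h0 i⟩ _ ⟨e1, e1⟩
      have jε := (hpc i j).joinedIn x0 ⟨h0 i, h0 j⟩ _ ⟨e2, e3⟩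
      have a1 := ih i jη.somePath (fun s => (jη.somePath_mem s).1)
      have a2 : jε.somePath.Homotopic δ := h j _ _ _ _ (fun s => (jε.somePath_mem s).2) hδ
      have a3 : (jη.somePath.trans (γ.subpath (t m) (t (m+1)))).Homotopic jε.somePath := by
        apply h i _ _ _ _ _ (fun s => (jε.somePath_mem s).1)
        intro s
        rw [Path.trans_apply]
        split_ifs
        · exact (jη.somePath_mem _).1
        · exact hsub _
      have a4 : (((γ.subpath 0 (t m)).cast γ.source.symm rfl).trans
          (γ.subpath (t m) (t (m+1)))).Homotopic
          ((γ.subpath 0 (t (m+1))).cast γ.source.symm rfl) := by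
        have := Path.Homotopic.pathCast
          (⟨Path.Homotopy.subpathTransSubpath γ 0 (t m) (t (m+1))⟩ : Path.Homotopic _ _)
          γ.source.symm rfl
        exact this
      exact a4.symm.trans (((a1.hcomp (Path.Homotopic.refl _)).trans a3).trans a2)
  have hN1 := hN N le_rfl
  have e : y = γ (t N) := by rw [hN1]; simp
  have k2 := (key N j (δ.cast rfl e.symm) hδ).pathCast rfl e
  have e3 : ((γ.subpath 0 (t N)).cast γ.source.symm rfl).cast rfl e = γ := by
    ext s
    change γ (Icc.convexComb 0 (t N) s) = γ s
    rw [hN1, Icc.convexComb_zero_one]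
  have e4 : (δ.cast rfl e.symm).cast rfl e = δ := by
    ext s; simp
  rwa [e3, e4] at k2

theorem aux_simply_connected {X : Type*} [TopologicalSpace X] {ι : Type*} (A : ι → Set X)
    (ho : ∀ i, IsOpen (A i)) (hc : ∀ x, ∃ i, x ∈ A i) (x0 : X) (h0 : ∀ i, x0 ∈ A i)
    (hpc : ∀ i j, IsPathConnected (A i ∩ A j))
    (h : ∀ i (a b : X) (p q : Path a b), (∀ t, p t ∈ A i) → (∀ t, q t ∈ A i) → p.Homotopic q) :
    SimplyConnectedSpace X := by
  have hj : ∀ x, ∃ i, JoinedIn (A i) x0 x := by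
    intro x
    obtain ⟨i, hi⟩ := hc x
    exact ⟨i, ((hpc i i).joinedIn x0 ⟨h0 i, h0 i⟩ _ ⟨hi, hi⟩).mono inter_subset_left⟩
  have H : ∀ {y : X} (p q : Path x0 y), p.Homotopic q := by
    intro y p q
    obtain ⟨i, hi⟩ := hj y
    exact (aux_paths_homotopic A ho hc x0 h0 hpc h p i hi.somePath hi.somePath_mem).trans
      (aux_paths_homotopic A ho hc x0 h0 hpc h q i hi.somePath hi.somePath_mem).symm
  rw [simply_connected_iff_paths_homotopic']
  refine ⟨⟨⟨x0⟩, fun x y => ?_⟩, fun {x y} p q => ?_⟩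
  · obtain ⟨_, hx⟩ := hj x
    obtain ⟨_, hy⟩ := hj y
    exact hx.joined.symm.trans hy.joined
  · obtain ⟨_, hx⟩ := hj x
    let c := hx.somePath
    have := H (c.trans p) (c.trans q)
    rw [← Path.Homotopic.Quotient.eq] at this ⊢
    simp only [Path.Homotopic.Quotient.mk_trans] at this
    have h2 := congrArg (Path.Homotopic.Quotient.trans
      (Path.Homotopic.Quotient.symm (Path.Homotopic.Quotient.mk c))) this
    simpa [← Path.Homotopic.Quotient.trans_assoc] using h2

theorem aux_null {X : Type*} [TopologicalSpace X] (A : Set X) 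
    (hA : ContinuousMap.Nullhomotopic (⟨Subtype.val, continuous_subtype_val⟩ : C(A, X)))
    (a b : X) (p q : Path a b) (hp : ∀ t, p t ∈ A) (hq : ∀ t, q t ∈ A) : p.Homotopic q := by
  obtain ⟨c, ⟨F⟩⟩ := hA
  have ha : a ∈ A := by simpa using hp 0
  have hb : b ∈ A := by simpa using hp 1
  have key : ∀ p : Path a b, (∀ t, p t ∈ A) → 
      (p.trans (F.evalAt ⟨b, hb⟩)).Homotopic (F.evalAt ⟨a, ha⟩) := by
    intro p hp
    let p' : Path (⟨a, ha⟩ : A) ⟨b, hb⟩ :=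
      { toFun := fun t => ⟨p t, hp t⟩
        continuous_toFun := by fun_prop
        source' := by simp
        target' := by simp }
    have := Path.Homotopic.map_trans_evalAt F p'
    refine Path.Homotopic.trans this ?_
    exact ⟨Path.Homotopy.transRefl _⟩
  have := (key p hp).trans (key q hq).symm
  rw [← Path.Homotopic.Quotient.eq] at this ⊢
  simp only [Path.Homotopic.Quotient.mk_trans] at this
  have h2 := congrArg (fun r => Path.Homotopic.Quotient.trans r
      (Path.Homotopic.Quotient.symm (Path.Homotopic.Quotient.mk (F.evalAt ⟨b, hb⟩)))) this
  simpa [Path.Homotopic.Quotient.trans_assoc] using h2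

/-- normalization -/
def nrm {n : ℕ} (v : {v : EuclideanSpace ℂ (Fin n) // v ≠ 0}) : Sph n :=
  ⟨(‖v.1‖⁻¹ : ℝ) • v.1, by
    have := norm_ne_zero_iff.2 v.2
    simp [norm_smul, this]⟩

theorem nrm_continuous {n : ℕ} : Continuous (nrm (n := n)) := by
  refine Continuous.subtype_mk ?_ _
  refine Continuous.smul (Continuous.inv₀ (continuous_norm.comp continuous_subtype_val) ?_)
    continuous_subtype_val
  intro v
  exact norm_ne_zero_iff.2 v.2

theorem sph_ne {n : ℕ} (x : Sph n) : (x : EuclideanSpace ℂ (Fin n)) ≠ 0 :=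
  ne_zero_of_mem_unit_sphere x

theorem nrm_sph {n : ℕ} (x : Sph n) (h : (x : EuclideanSpace ℂ (Fin n)) ≠ 0) :
    nrm ⟨x, h⟩ = x := by
  apply Subtype.ext
  simp [nrm]

theorem wt_norm {n r : ℕ} (z : Fin r → Fin n → ℤ) (t : Fin r → Circle)
    (v w : EuclideanSpace ℂ (Fin n)) (h : ∀ k, (weightProd z t k : ℂ) * v k = w k) :
    ‖w‖ = ‖v‖ := by
  simp only [EuclideanSpace.norm_eq, ← h, norm_mul, Circle.norm_coe, one_mul]

theorem nrm_rel {n r : ℕ} (z : Fin r → Fin n → ℤ) (t : Fin r → Circle)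
    (v w : {v : EuclideanSpace ℂ (Fin n) // v ≠ 0})
    (h : ∀ k, (weightProd z t k : ℂ) * v.1 k = w.1 k) :
    (Quotient.mk (orbitSetoid z) (nrm v)) = Quotient.mk _ (nrm w) := by
  apply Quotient.sound
  refine ⟨t, fun k => ?_⟩
  have := wt_norm z t _ _ h
  simp only [nrm, this, PiLp.smul_apply, Complex.real_smul, ← h]
  ring

theorem mk_open {n r : ℕ} (z : Fin r → Fin n → ℤ) :
    IsOpenQuotientMap (Quotient.mk (orbitSetoid z)) := by
  refine ⟨Quotient.mk_surjective, continuous_quotient_mk', ?_⟩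
  intro U hU
  rw [← isQuotientMap_quotient_mk'.isOpen_preimage]
  let act : (Fin r → Circle) → Sph n → Sph n := fun t x =>
    ⟨WithLp.toLp 2 (fun k => (weightProd z t k : ℂ) * x.1 k), by
      have := wt_norm z t x.1 (WithLp.toLp 2 (fun k => (weightProd z t k : ℂ) * x.1 k))
        (fun k => rfl)
      simp [this]⟩
  have hact : ∀ t, Continuous (act t) := by
    intro t
    refine Continuous.subtype_mk ?_ _
    fun_prop
  have : Quotient.mk (orbitSetoid z) ⁻¹' (Quotient.mk (orbitSetoid z) '' U)
      = ⋃ t, act t ⁻¹' U := by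
    ext x
    simp only [mem_preimage, mem_image, mem_iUnion]
    constructor
    · rintro ⟨y, hy, hxy⟩
      obtain ⟨t, ht⟩ := Quotient.exact hxy.symm
      refine ⟨t, ?_⟩
      have : act t x = y := by
        apply Subtype.ext
        ext k
        exact ht k
      rwa [this]
    · rintro ⟨t, ht⟩
      exact ⟨_, ht, Quotient.sound ((orbitSetoid z).symm ⟨t, fun k => rfl⟩)⟩
  change IsOpen (Quotient.mk (orbitSetoid z) ⁻¹' (Quotient.mk (orbitSetoid z) '' U))
  rw [this]
  exact isOpen_iUnion fun t => hU.preimage (hact t)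

/-- the open sets -/
def AA {n r : ℕ} (z : Fin r → Fin n → ℤ) (j : Fin n) : Set (OrbitSpace z) :=
  Quotient.mk (orbitSetoid z) '' {x | (x : EuclideanSpace ℂ (Fin n)) j ≠ 0}

theorem mem_AA {n r : ℕ} (z : Fin r → Fin n → ℤ) (j : Fin n) (x : Sph n) :
    Quotient.mk (orbitSetoid z) x ∈ AA z j ↔ (x : EuclideanSpace ℂ (Fin n)) j ≠ 0 := by
  constructor
  · rintro ⟨y, hy, hxy⟩
    obtain ⟨t, ht⟩ := Quotient.exact hxy
    rw [← ht j]
    exact mul_ne_zero (Circle.coe_ne_zero _) hy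
  · intro h
    exact ⟨x, h, rfl⟩

theorem AA_open {n r : ℕ} (z : Fin r → Fin n → ℤ) (j : Fin n) : IsOpen (AA z j) := by
  apply (mk_open z).isOpenMap
  have : Continuous fun x : Sph n => (x : EuclideanSpace ℂ (Fin n)) j := by fun_prop
  exact isOpen_ne.preimage this

theorem AA_cover {n r : ℕ} (z : Fin r → Fin n → ℤ) (q : OrbitSpace z) : ∃ j, q ∈ AA z j := by
  induction q using Quotient.inductionOn with
  | h x =>
    by_contra hcon
    push Not at hcon
    apply sph_ne x
    ext j
    have := hcon j
    rw [mem_AA, not_not] at this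
    simpa using this

theorem AA_path {n r : ℕ} (z : Fin r → Fin n → ℤ) (i j : Fin n) :
    IsPathConnected (AA z i ∩ AA z j) := by
  classical
  have h1 : IsPathConnected (Set.univ.pi fun k : Fin n =>
      if k = i ∨ k = j then ({0}ᶜ : Set ℂ) else Set.univ) := by
    apply IsPathConnected.pi
    intro k
    split_ifs
    · exact isPathConnected_compl_singleton_of_one_lt_rank (by simp) 0
    · exact isPathConnected_univ
  have h2 := h1.image (PiLp.continuous_toLp 2 (fun _ : Fin n => ℂ))
  have h3 := h2.preimage_coe (U := {v : EuclideanSpace ℂ (Fin n) | v ≠ 0}) (by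
    rintro _ ⟨v, hv, rfl⟩ h0
    have := hv i trivial
    simp only [true_or, if_true] at this
    apply this
    have := congrArg (fun w : EuclideanSpace ℂ (Fin n) => w i) h0
    simpa using this)
  have h4 := h3.image ((mk_open z).continuous.comp (nrm_continuous (n := n)))
  convert h4 using 1
  ext q
  induction q using Quotient.inductionOn with
  | h x =>
    constructor
    · rintro ⟨ha, hb⟩
      refine ⟨⟨x, sph_ne x⟩, ⟨x.1.ofLp, ?_, rfl⟩, ?_⟩
      · intro k _
        change x.1.ofLp k ∈ ite _ _ _
        split_ifs with hk
        · rcases hk with rfl | rfl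
          · exact (mem_AA z _ x).1 ha
          · exact (mem_AA z _ x).1 hb
        · trivial
      · simp [nrm_sph]
    · rintro ⟨⟨v, hv0⟩, ⟨w, hw, hwv⟩, hq⟩
      rw [← hq]
      have hwv : WithLp.toLp 2 w = v := hwv
      have hi := hw i trivial
      have hj := hw j trivial
      simp only [true_or, or_true, if_true] at hi hj
      have n0 := norm_ne_zero_iff.2 hv0
      have e : ∀ k, v k = w k := fun k => by rw [← hwv]
      constructor
      · refine (mem_AA z _ _).2 ?_
        simp only [nrm, PiLp.smul_apply, e]
        exact smul_ne_zero (inv_ne_zero n0) hi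
      · refine (mem_AA z _ _).2 ?_
        simp only [nrm, PiLp.smul_apply, e]
        exact smul_ne_zero (inv_ne_zero n0) hj

theorem descend {n r : ℕ} (z : Fin r → Fin n → ℤ) (j : Fin n)
    (Φ : I → EuclideanSpace ℂ (Fin n) → EuclideanSpace ℂ (Fin n))
    (hΦ : Continuous fun p : I × EuclideanSpace ℂ (Fin n) => Φ p.1 p.2)
    (h0 : ∀ s x, x j ≠ 0 → Φ s x ≠ 0)
    (hrel : ∀ s x y t, (∀ k, (weightProd z t k : ℂ) * x k = y k) →
      ∃ t, ∀ k, (weightProd z t k : ℂ) * Φ s x k = Φ s y k) :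
    ∃ F : C(I × AA z j, OrbitSpace z), ∀ s (x : Sph n) (hx : x.1 j ≠ 0),
      F (s, ⟨Quotient.mk _ x, (mem_AA z j x).2 hx⟩) = Quotient.mk _ (nrm ⟨Φ s x.1, h0 s _ hx⟩) := by
  have hq : IsOpenQuotientMap (Prod.map (id : I → I)
      ((AA z j).restrictPreimage (Quotient.mk (orbitSetoid z)))) :=
    IsOpenQuotientMap.id.prodMap ((mk_open z).restrictPreimage (AA z j))
  let g : C(I × (Quotient.mk (orbitSetoid z) ⁻¹' AA z j), OrbitSpace z) :=
    ⟨fun p => Quotient.mk _ (nrm ⟨Φ p.1 p.2.1.1, h0 _ _ ((mem_AA z j _).1 p.2.2)⟩), by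
      refine (mk_open z).continuous.comp (nrm_continuous.comp (Continuous.subtype_mk ?_ _))
      exact hΦ.comp (f := fun p : I × (Quotient.mk (orbitSetoid z) ⁻¹' AA z j) => 
        (p.1, p.2.1.1)) (by fun_prop)⟩
  let f : C(I × (Quotient.mk (orbitSetoid z) ⁻¹' AA z j), I × AA z j) := ⟨_, hq.continuous⟩
  have hf : IsQuotientMap f := hq.isQuotientMap
  have hfg : Function.FactorsThrough g f := by
    rintro ⟨s, x⟩ ⟨s', y⟩ hxy
    have e1 : s = s' := congrArg Prod.fst hxy
    have e2 : Quotient.mk (orbitSetoid z) x.1 = Quotient.mk (orbitSetoid z) y.1 :=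
      congrArg (fun p => p.2.1) hxy
    subst e1
    obtain ⟨t, ht⟩ := Quotient.exact e2
    obtain ⟨t', ht'⟩ := hrel s _ _ t ht
    exact nrm_rel z t' _ _ ht'
  refine ⟨hf.lift g hfg, fun s x hx => ?_⟩
  have := congrArg (fun φ : C(_, _) => φ (s, ⟨x, (mem_AA z j x).2 hx⟩)) (hf.lift_comp g hfg)
  exact this

theorem exists_wt {n r : ℕ} (z : Fin r → Fin n → ℤ) (j : Fin n) (i : Fin r) (hi : z i j ≠ 0)
    (c : Circle) : ∃ t, weightProd z t j = c := by
  classical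
  refine ⟨Function.update 1 i (Circle.exp (Complex.arg c / z i j)), ?_⟩
  rw [weightProd, Finset.prod_eq_single i]
  · rw [Function.update_self, ← Circle.exp_zsmul, zsmul_eq_mul, mul_div_cancel₀ _ (by exact_mod_cast hi)]
    exact Circle.exp_arg c
  · intro b _ hb
    simp [Function.update_of_ne hb]
  · simp

theorem AA_null {n r : ℕ} (hn : 2 ≤ n) (z : Fin r → Fin n → ℤ) (j : Fin n) :
    ContinuousMap.Nullhomotopic
      (⟨Subtype.val, continuous_subtype_val⟩ : C(AA z j, OrbitSpace z)) := by
  classical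
  have hcst : ∀ (s : I) (c : ℂ), ((1 - (s:ℝ) : ℝ) : ℂ) * c + ((s:ℝ) : ℂ) * c = c := by
    intro s c; push_cast; ring
  obtain ⟨F, hF⟩ := descend z j
    (fun s x => WithLp.toLp 2 fun k =>
      ((1 - (s:ℝ) : ℝ) : ℂ) * x k + ((s:ℝ) : ℂ) * (if k = j then x k else 0))
    (by
      refine (PiLp.continuous_toLp 2 _).comp (continuous_pi fun k => ?_)
      split_ifs <;> fun_prop)
    (by
      intro s x hx h
      have := congrArg (fun w : EuclideanSpace ℂ (Fin n) => w j) h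
      simp only [if_true, hcst] at this
      exact hx this)
    (by
      intro s x y t h
      refine ⟨t, fun k => ?_⟩
      simp only [← h]
      split_ifs <;> ring)
  have hF0 : ∀ q, F (0, q) = q.1 := by
    rintro ⟨q, hq⟩
    induction q using Quotient.inductionOn with
    | h x =>
      rw [hF 0 x ((mem_AA z j x).1 hq)]
      simp [nrm_sph]
  have H1 : ContinuousMap.Homotopic
      (⟨Subtype.val, continuous_subtype_val⟩ : C(AA z j, OrbitSpace z))
      (F.comp ⟨fun q => (1, q), by fun_prop⟩) :=
    ⟨⟨F, fun q => hF0 q, fun q => rfl⟩⟩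
  by_cases hz : ∃ i, z i j ≠ 0
  · obtain ⟨i, hi⟩ := hz
    have hne : EuclideanSpace.single j (1:ℂ) ≠ 0 := by simp
    refine ⟨Quotient.mk _ (nrm ⟨EuclideanSpace.single j (1:ℂ), hne⟩), ?_⟩
    convert H1 using 1
    ext ⟨q, hq⟩
    induction q using Quotient.inductionOn with
    | h x =>
      have hx := (mem_AA z j x).1 hq
      change _ = F (1, _)
      rw [hF 1 x hx]
      have hx' : ‖x.1 j‖ ≠ 0 := norm_ne_zero_iff.2 hx
      obtain ⟨t, ht⟩ := exists_wt z j i hi (⟨x.1 j / ‖x.1 j‖, by simp [Submonoid.unitSphere, hx']⟩)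
      have hne2 : EuclideanSpace.single j (‖x.1 j‖:ℂ) ≠ 0 := by simpa using hx
      have e1 : nrm ⟨EuclideanSpace.single j (1:ℂ), hne⟩
          = nrm ⟨EuclideanSpace.single j (‖x.1 j‖:ℂ), hne2⟩ := by
        apply Subtype.ext
        ext k
        by_cases hkj : k = j
        · subst hkj
          simp [nrm, hx']
        · simp [nrm, hkj]
      rw [ContinuousMap.const_apply, e1]
      refine nrm_rel z t _ _ fun k => ?_
      by_cases hkj : k = j
      · subst hkj
        have hx2 : (‖x.1 k‖ : ℂ) ≠ 0 := by exact_mod_cast hx'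
        simp [ht, hx2]
      · simp [hkj]
  · push Not at hz
    have : Nontrivial (Fin n) := Fin.nontrivial_iff_two_le.2 hn
    obtain ⟨k, hk⟩ := exists_ne j
    obtain ⟨G, hG⟩ := descend z j
      (fun s x => WithLp.toLp 2 fun l =>
        ((1 - (s:ℝ) : ℝ) : ℂ) * (if l = j then x l else 0)
          + ((s:ℝ) : ℂ) * (if l = k then 1 else 0))
      (by
        refine (PiLp.continuous_toLp 2 _).comp (continuous_pi fun k => ?_)
        split_ifs <;> fun_prop)
      (by
        intro s x hx h
        have e1 := congrArg (fun w : EuclideanSpace ℂ (Fin n) => w j) h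
        have e2 := congrArg (fun w : EuclideanSpace ℂ (Fin n) => w k) h
        simp [hk] at e2
        simp [hk.symm, e2] at e1
        exact hx e1)
      (by
        intro s x y t h
        refine ⟨1, fun l => ?_⟩
        have hj : x j = y j := by
          rw [← h j]
          simp [weightProd, hz]
        by_cases hl : l = j
        · subst hl
          simp [weightProd, hj]
        · simp [weightProd, hl])
    have hne : EuclideanSpace.single k (1:ℂ) ≠ 0 := by simp
    refine ⟨Quotient.mk _ (nrm ⟨EuclideanSpace.single k (1:ℂ), hne⟩), H1.trans ⟨⟨G, ?_, ?_⟩⟩⟩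
    · rintro ⟨q, hq⟩
      induction q using Quotient.inductionOn with
      | h x =>
        have hx := (mem_AA z j x).1 hq
        change G (0, _) = F (1, _)
        rw [hF 1 x hx, hG 0 x hx]
        congr 3
        ext l
        simp
    · rintro ⟨q, hq⟩
      induction q using Quotient.inductionOn with
      | h x =>
        have hx := (mem_AA z j x).1 hq
        change G (1, _) = _
        rw [hG 1 x hx, ContinuousMap.const_apply]
        congr 3
        ext l
        simp [Pi.single_apply]

theorem exists_base {n r : ℕ} (hn : 2 ≤ n) (z : Fin r → Fin n → ℤ) :
    ∃ x0, ∀ j, x0 ∈ AA z j := by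
  have hne : (WithLp.toLp 2 (fun _ => 1) : EuclideanSpace ℂ (Fin n)) ≠ 0 := by
    intro h
    have := congrArg (fun w : EuclideanSpace ℂ (Fin n) => w ⟨0, by omega⟩) h
    simp at this
  refine ⟨Quotient.mk _ (nrm ⟨_, hne⟩), fun j => (mem_AA z j _).2 ?_⟩
  simp only [nrm, PiLp.smul_apply]
  exact smul_ne_zero (inv_ne_zero (norm_ne_zero_iff.2 hne)) one_ne_zero

/-- If `n ≥ 2`, then the orbit space `X_z` of any linear torus action on
the sphere `S^{2n-1}` given by a weight matrix `z` is simply connected. -/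
theorem orbitSpace_simplyConnectedSpace (n r : ℕ) (hn : 2 ≤ n) (z : Fin r → Fin n → ℤ) :
    SimplyConnectedSpace (OrbitSpace z) := by
  obtain ⟨x0, h0⟩ := exists_base hn z
  exact aux_simply_connected (AA z) (AA_open z) (AA_cover z) x0 h0 (AA_path z)
    (fun j => aux_null (AA z j) (AA_null hn z j))
end
end

section
/- If some column of z is a coloop of the column matroid, i.e. there is an index j₀ ∈ Fin n such that the column (i ↦ (z i j₀ : ℚ)) does not lie in the ℚ-span of the remaining columns {(i ↦ (z i j : ℚ)) | j ≠ j₀}, then the orbit space X_z is contractible. -/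
open scoped BigOperators

noncomputable section

lemma coloop_int {n r : ℕ} (z : Fin r → Fin n → ℤ) (j₀ : Fin n)
    (h : (fun i => (z i j₀ : ℚ)) ∉
      Submodule.span ℚ ((fun j => fun i => (z i j : ℚ)) '' {j | j ≠ j₀})) :
    ∃ m : Fin r → ℤ, (∀ j, j ≠ j₀ → ∑ i, m i * z i j = 0) ∧ ∑ i, m i * z i j₀ ≠ 0 := by
  obtain ⟨f, hf, hle⟩ := Submodule.exists_le_ker_of_notMem h
  obtain ⟨b, hb⟩ := IsLocalization.exist_integer_multiples_of_finite (nonZeroDivisors ℤ)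
    (fun i : Fin r => f (Pi.single i 1))
  choose m hm using hb
  have hb0 : ((b : ℤ) : ℚ) ≠ 0 := by
    exact_mod_cast nonZeroDivisors.ne_zero b.2
  have key : ∀ j, ((∑ i, m i * z i j : ℤ) : ℚ) = ((b : ℤ) : ℚ) * f (fun i => (z i j : ℚ)) := by
    intro j
    rw [LinearMap.pi_apply_eq_sum_univ f (fun i => (z i j : ℚ)), Finset.mul_sum]
    push_cast
    refine Finset.sum_congr rfl fun i _ => ?_
    have h1 := hm i
    have h2 : (fun k => if i = k then (1 : ℚ) else 0) = Pi.single i 1 := by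
      ext k; simp [Pi.single_apply, eq_comm]
    rw [h2]
    simp only [eq_intCast, zsmul_eq_mul] at h1
    rw [h1, smul_eq_mul]
    ring
  refine ⟨m, fun j hj => ?_, fun h0 => ?_⟩
  · have : f (fun i => (z i j : ℚ)) = 0 := hle (Submodule.subset_span ⟨j, hj, rfl⟩)
    have k := key j
    rw [this, mul_zero] at k
    exact_mod_cast k
  · have k := key j₀
    rw [h0, Int.cast_zero] at k
    exact (mul_ne_zero hb0 hf) k.symm

lemma circle_zpow_surj (d : ℤ) (hd : d ≠ 0) (w : Circle) : ∃ u : Circle, u ^ d = w := by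
  refine ⟨Circle.exp (Complex.arg w / d), ?_⟩
  rw [← Circle.exp_zsmul, zsmul_eq_mul, mul_div_cancel₀]
  · exact Circle.exp_arg w
  · exact_mod_cast hd

lemma coloop_torus {n r : ℕ} (z : Fin r → Fin n → ℤ) (j₀ : Fin n)
    (h : (fun i => (z i j₀ : ℚ)) ∉
      Submodule.span ℚ ((fun j => fun i => (z i j : ℚ)) '' {j | j ≠ j₀})) (w : Circle) :
    ∃ t : Fin r → Circle, (∀ j, j ≠ j₀ → weightProd z t j = 1) ∧ weightProd z t j₀ = w := by
  obtain ⟨m, hm, hd⟩ := coloop_int z j₀ h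
  obtain ⟨u, hu⟩ := circle_zpow_surj _ hd w
  have key : ∀ j, weightProd z (fun i => u ^ m i) j = u ^ (∑ i, m i * z i j) := by
    intro j
    simp only [weightProd, ← zpow_mul]
    have hs : ∀ S : Finset (Fin r), ∏ i ∈ S, u ^ (m i * z i j) = u ^ (∑ i ∈ S, m i * z i j) := by
      intro S
      induction S using Finset.induction_on with
      | empty => simp
      | insert a S ha ih => rw [Finset.prod_insert ha, Finset.sum_insert ha, zpow_add, ih]
    exact hs _
  refine ⟨fun i => u ^ m i, fun j hj => ?_, ?_⟩
  · rw [key, hm j hj, zpow_zero]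
  · rw [key, hu]

/-- unnormalized homotopy -/
def preH {n : ℕ} (j₀ : Fin n) (s : ℝ) (x : EuclideanSpace ℂ (Fin n)) :
    EuclideanSpace ℂ (Fin n) :=
  WithLp.toLp 2 fun j => if j = j₀ then (((1 - s) * ‖x j₀‖ + s : ℝ) : ℂ) else ((1 - s : ℝ) : ℂ) * x j

lemma preH_continuous {n : ℕ} (j₀ : Fin n) :
    Continuous fun p : ℝ × EuclideanSpace ℂ (Fin n) => preH j₀ p.1 p.2 := by
  unfold preH
  refine (PiLp.continuous_toLp 2 _).comp (continuous_pi fun j => ?_)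
  split_ifs <;> fun_prop

lemma preH_ne_zero {n : ℕ} (j₀ : Fin n) (s : unitInterval) (x : Sph n) :
    preH j₀ s (x : EuclideanSpace ℂ (Fin n)) ≠ 0 := by
  intro h0
  have hj : ∀ j, preH j₀ s (x : EuclideanSpace ℂ (Fin n)) j = 0 := fun j => by rw [h0]; rfl
  have h1 := hj j₀
  simp only [preH, if_true, Complex.ofReal_eq_zero] at h1
  have hs0 := s.2.1
  have hs1 := s.2.2
  have hn := norm_nonneg ((x : EuclideanSpace ℂ (Fin n)) j₀)
  have hs : (s : ℝ) = 0 := by nlinarith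
  rw [hs] at h1
  have hx : (x : EuclideanSpace ℂ (Fin n)) = 0 := by
    ext j
    by_cases hjj : j = j₀
    · subst hjj
      have : ‖(x : EuclideanSpace ℂ (Fin n)) j‖ = 0 := by linarith
      simpa using this
    · have h2 := hj j
      simpa [preH, hjj, hs] using h2
  have := norm_eq_of_mem_sphere x
  rw [hx, norm_zero] at this
  exact zero_ne_one this

/-- normalized homotopy -/
def nH {n : ℕ} (j₀ : Fin n) (x : Sph n) (s : unitInterval) : Sph n :=
  ⟨(‖preH j₀ s (x : EuclideanSpace ℂ (Fin n))‖⁻¹ : ℝ) • preH j₀ s (x : EuclideanSpace ℂ (Fin n)), by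
    rw [mem_sphere_zero_iff_norm, norm_smul, norm_inv, norm_norm,
      inv_mul_cancel₀ (norm_ne_zero_iff.2 (preH_ne_zero j₀ s x))]⟩

lemma nH_continuous {n : ℕ} (j₀ : Fin n) :
    Continuous fun p : Sph n × unitInterval => nH j₀ p.1 p.2 := by
  have hc : Continuous fun p : Sph n × unitInterval =>
      preH j₀ p.2 (p.1 : EuclideanSpace ℂ (Fin n)) :=
    (preH_continuous j₀).comp (by fun_prop : Continuous fun p : Sph n × unitInterval =>
      ((p.2 : ℝ), (p.1 : EuclideanSpace ℂ (Fin n))))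
  refine Continuous.subtype_mk ?_ _
  exact (hc.norm.inv₀ fun p => norm_ne_zero_iff.2 (preH_ne_zero j₀ p.2 p.1)).smul hc

lemma norm_eq_of_rel {n : ℕ} (c : Fin n → Circle) (v w : EuclideanSpace ℂ (Fin n))
    (h : ∀ j, (c j : ℂ) * v j = w j) : ‖v‖ = ‖w‖ := by
  rw [EuclideanSpace.norm_eq, EuclideanSpace.norm_eq]
  simp only [← h, norm_mul, Circle.norm_coe, one_mul]

lemma nH_rel {n r : ℕ} (z : Fin r → Fin n → ℤ) (j₀ : Fin n)
    (h : (fun i => (z i j₀ : ℚ)) ∉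
      Submodule.span ℚ ((fun j => fun i => (z i j : ℚ)) '' {j | j ≠ j₀}))
    (x y : Sph n) (hxy : (orbitSetoid z) x y) (s : unitInterval) :
    (orbitSetoid z) (nH j₀ x s) (nH j₀ y s) := by
  obtain ⟨t, ht⟩ := hxy
  obtain ⟨t', h1, h2⟩ := coloop_torus z j₀ h (weightProd z t j₀)⁻¹
  have hmul : ∀ j, weightProd z (t * t') j = weightProd z t j * weightProd z t' j := fun j => by
    simp [weightProd, mul_zpow, Finset.prod_mul_distrib]
  have hp : ∀ j, (weightProd z (t * t') j : ℂ) * preH j₀ s (x : EuclideanSpace ℂ (Fin n)) j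
      = preH j₀ s (y : EuclideanSpace ℂ (Fin n)) j := by
    intro j
    rw [hmul]
    by_cases hj : j = j₀
    · subst hj
      rw [h2, mul_inv_cancel]
      simp only [preH, ← ht, norm_mul, Circle.norm_coe, one_mul, Circle.coe_one, if_true]
    · rw [h1 j hj]
      simp only [preH, hj, if_false, ← ht j, mul_one]
      ring
  refine ⟨t * t', fun j => ?_⟩
  simp only [nH, PiLp.smul_apply, Complex.real_smul]
  rw [norm_eq_of_rel _ _ _ hp, ← hp j]
  ring

lemma nH_zero {n r : ℕ} (z : Fin r → Fin n → ℤ) (j₀ : Fin n)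
    (h : (fun i => (z i j₀ : ℚ)) ∉
      Submodule.span ℚ ((fun j => fun i => (z i j : ℚ)) '' {j | j ≠ j₀})) (x : Sph n) :
    (orbitSetoid z) (nH j₀ x 0) x := by
  obtain ⟨t, h1, h2⟩ := coloop_torus z j₀ h
    (Circle.exp (Complex.arg ((x : EuclideanSpace ℂ (Fin n)) j₀)))
  have hp : ∀ j, (weightProd z t j : ℂ) *
      preH j₀ (0 : unitInterval) (x : EuclideanSpace ℂ (Fin n)) j
      = (x : EuclideanSpace ℂ (Fin n)) j := by
    intro j
    by_cases hj : j = j₀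
    · subst hj
      rw [h2]
      simp only [preH, if_true, Set.Icc.coe_zero, sub_zero, one_mul, add_zero, Circle.coe_exp]
      rw [mul_comm, Complex.norm_mul_exp_arg_mul_I]
    · rw [h1 j hj]
      simp [preH, hj]
  refine ⟨t, fun j => ?_⟩
  have hn := norm_eq_of_rel _ _ _ hp
  rw [norm_eq_of_mem_sphere x] at hn
  simp only [nH, PiLp.smul_apply, Complex.real_smul]
  rw [hn, ← hp j]
  simp

lemma nH_one {n : ℕ} (j₀ : Fin n) (x y : Sph n) : nH j₀ x 1 = nH j₀ y 1 := by
  have : preH j₀ (1 : unitInterval) (x : EuclideanSpace ℂ (Fin n)) =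
      preH j₀ (1 : unitInterval) (y : EuclideanSpace ℂ (Fin n)) := by
    simp [preH]
  simp only [nH, this]

/-- If some column of `z` is a coloop of the column matroid, i.e. there is
`j₀` such that the `j₀`-th column does not lie in the ℚ-span of the remaining columns, then
the orbit space `X_z` is contractible. -/
theorem orbitSpace_contractible_of_coloop (n r : ℕ) (z : Fin r → Fin n → ℤ) (j₀ : Fin n)
    (h : (fun i => (z i j₀ : ℚ)) ∉
      Submodule.span ℚ ((fun j => fun i => (z i j : ℚ)) '' {j | j ≠ j₀})) :
    ContractibleSpace (OrbitSpace z) := by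
  classical
  let e : Sph n := ⟨EuclideanSpace.single j₀ 1, by simp⟩
  let F : C(Sph n × unitInterval, OrbitSpace z) :=
    ⟨fun p => Quotient.mk (orbitSetoid z) (nH j₀ p.1 p.2),
      continuous_quotient_mk'.comp (nH_continuous j₀)⟩
  let G : C(OrbitSpace z, C(unitInterval, OrbitSpace z)) :=
    ⟨Quotient.lift F.curry fun x y hxy => by
      ext s
      exact Quotient.sound (nH_rel z j₀ h x y hxy s), F.curry.continuous.quotient_lift _⟩
  rw [contractible_iff_id_nullhomotopic]
  refine ⟨Quotient.mk _ (nH j₀ e 1), ⟨⟨⟨fun p => G p.2 p.1, ?_⟩, ?_, ?_⟩⟩⟩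
  · exact G.uncurry.continuous.comp continuous_swap
  · intro q
    induction q using Quotient.inductionOn with
    | h x => exact Quotient.sound (nH_zero z j₀ h x)
  · intro q
    induction q using Quotient.inductionOn with
    | h x => exact congrArg (Quotient.mk (orbitSetoid z)) (nH_one j₀ x e)
end
end

section
/- Let r = 1 and n = 2, and let the weight matrix be z = [a₁ a₂] with a₁ ≠ 0 and a₂ ≠ 0. Then the orbit space X_z (the quotient of S³ by the circle acting with weights a₁, a₂) is homeomorphic to the 2-sphere, i.e. to Metric.sphere (0 : EuclideanSpace ℝ (Fin 3)) 1. -/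
open scoped BigOperators

noncomputable section

def phi (k : ℤ) (x : ℂ) : ℂ := (‖x‖ : ℂ) * (x / (‖x‖ : ℂ)) ^ k

lemma nc (c : Circle) : ‖(c : ℂ)‖ = 1 := Circle.norm_coe c

lemma phi_polar (k : ℤ) (r : ℝ) (hr : 0 ≤ r) (c : Circle) :
    phi k ((r : ℂ) * c) = (r : ℂ) * ((c ^ k : Circle) : ℂ) := by
  rcases hr.eq_or_lt with rfl | hr'
  · simp [phi]
  · have h : ‖(r : ℂ) * c‖ = r := by rw [norm_mul, nc]; simp [abs_of_pos hr']
    have h0 : (r : ℂ) ≠ 0 := by exact_mod_cast hr'.ne'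
    rw [phi, h, mul_div_cancel_left₀ _ h0, Circle.coe_zpow]

lemma exists_polar (x : ℂ) : ∃ c : Circle, x = (‖x‖ : ℂ) * c := by
  refine ⟨Circle.exp x.arg, ?_⟩
  rw [Circle.coe_exp, Complex.norm_mul_exp_arg_mul_I]

lemma norm_phi (k : ℤ) (x : ℂ) : ‖phi k x‖ = ‖x‖ := by
  obtain ⟨c, hc⟩ := exists_polar x
  rw [hc, phi_polar _ _ (norm_nonneg x), norm_mul, norm_mul, nc, nc]

lemma phi_smul (k : ℤ) (c : Circle) (x : ℂ) :
    phi k (c * x) = ((c ^ k : Circle) : ℂ) * phi k x := by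
  obtain ⟨d, hd⟩ := exists_polar x
  have e : (c : ℂ) * x = (‖x‖ : ℂ) * ((c * d : Circle) : ℂ) := by
    rw [Circle.coe_mul]; nth_rewrite 1 [hd]; ring
  rw [e, phi_polar _ _ (norm_nonneg x)]
  have e2 : phi k x = (‖x‖ : ℂ) * ((d ^ k : Circle) : ℂ) := by
    rw [← phi_polar _ _ (norm_nonneg x), ← hd]
  rw [e2, mul_zpow, Circle.coe_mul]
  ring

lemma continuous_phi (k : ℤ) : Continuous (phi k) := by
  rw [continuous_iff_continuousAt]
  intro x
  by_cases hx : x = 0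
  · subst hx
    have h0 : phi k 0 = 0 := by simp [phi]
    rw [ContinuousAt, h0, tendsto_zero_iff_norm_tendsto_zero]
    simp only [norm_phi]
    exact tendsto_norm_zero
  · have hn : (‖x‖ : ℂ) ≠ 0 := by simpa using hx
    have hc : ContinuousAt (fun x : ℂ => (‖x‖ : ℂ)) x := by fun_prop
    unfold phi
    exact hc.mul ((continuousAt_id.div hc hn).zpow₀ k (Or.inl (div_ne_zero hx hn)))

lemma circle_root (k : ℤ) (hk : k ≠ 0) (c : Circle) : ∃ t : Circle, t ^ k = c := by
  refine ⟨Circle.exp ((c : ℂ).arg / k), ?_⟩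
  have hk' : (k : ℝ) ≠ 0 := by exact_mod_cast hk
  rw [← Circle.exp_zsmul, zsmul_eq_mul, mul_div_cancel₀ _ hk', Circle.exp_arg]

lemma exists_circle {x y : ℂ} (h : ‖x‖ = ‖y‖) : ∃ c : Circle, (c : ℂ) * x = y := by
  obtain ⟨c, hc⟩ := exists_polar x
  obtain ⟨d, hd⟩ := exists_polar y
  refine ⟨d / c, ?_⟩
  rw [hd, hc, h, Circle.coe_div]
  have := Circle.coe_ne_zero c
  field_simp

def wmap (a b : ℤ) (x y : ℂ) : ℂ := 2 * (phi b x * phi (-a) y)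

lemma norm_wmap (a b : ℤ) (x y : ℂ) : ‖wmap a b x y‖ = 2 * (‖x‖ * ‖y‖) := by
  simp [wmap, norm_phi]

lemma wmap_smul (a b : ℤ) (c d : Circle) (x y : ℂ) :
    wmap a b (c * x) (d * y) = ((c ^ b * d ^ (-a) : Circle) : ℂ) * wmap a b x y := by
  simp only [wmap, phi_smul, Circle.coe_mul]; ring

lemma sph_norm (x : Sph 2) : ‖x.1 0‖ ^ 2 + ‖x.1 1‖ ^ 2 = 1 := by
  have h := x.2
  rw [mem_sphere_zero_iff_norm] at h
  have := EuclideanSpace.norm_sq_eq x.1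
  rw [h, Fin.sum_univ_two] at this
  linarith

def fmap (a b : ℤ) (x : Sph 2) : Metric.sphere (0 : EuclideanSpace ℝ (Fin 3)) 1 :=
  ⟨!₂[‖x.1 0‖ ^ 2 - ‖x.1 1‖ ^ 2, (wmap a b (x.1 0) (x.1 1)).re, (wmap a b (x.1 0) (x.1 1)).im], by
    have h1 := sph_norm x
    have h2 := norm_wmap a b (x.1 0) (x.1 1)
    have h3 := Complex.sq_norm (wmap a b (x.1 0) (x.1 1))
    rw [Complex.normSq_apply, h2] at h3
    rw [mem_sphere_zero_iff_norm, ← sq_eq_sq₀ (norm_nonneg _) zero_le_one,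
      EuclideanSpace.norm_sq_eq, Fin.sum_univ_three]
    simp only [Real.norm_eq_abs, sq_abs]
    simp
    have : (‖x.1 0‖ ^ 2 + ‖x.1 1‖ ^ 2) ^ 2 = 1 := by rw [h1]; norm_num
    nlinarith⟩

lemma continuous_fmap (a b : ℤ) : Continuous (fmap a b) := by
  have c0 : Continuous (fun x : Sph 2 => x.1 0) := by fun_prop
  have c1 : Continuous (fun x : Sph 2 => x.1 1) := by fun_prop
  have cw : Continuous (fun x : Sph 2 => wmap a b (x.1 0) (x.1 1)) :=
    continuous_const.mul (((continuous_phi b).comp c0).mul ((continuous_phi (-a)).comp c1))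
  refine Continuous.subtype_mk ?_ _
  refine (PiLp.continuous_toLp 2 _).comp (continuous_pi fun i => ?_)
  fin_cases i
  · exact (c0.norm.pow 2).sub (c1.norm.pow 2)
  · exact Complex.continuous_re.comp cw
  · exact Complex.continuous_im.comp cw

lemma fmap_eq_iff (a b : ℤ) (x y : Sph 2) : fmap a b x = fmap a b y ↔
    (‖x.1 0‖ = ‖y.1 0‖ ∧ ‖x.1 1‖ = ‖y.1 1‖) ∧
      wmap a b (x.1 0) (x.1 1) = wmap a b (y.1 0) (y.1 1) := by
  constructor
  · intro h
    have e := congrArg Subtype.val h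
    have e0 := congrArg (fun v : EuclideanSpace ℝ (Fin 3) => v 0) e
    have e1 := congrArg (fun v : EuclideanSpace ℝ (Fin 3) => v 1) e
    have e2 := congrArg (fun v : EuclideanSpace ℝ (Fin 3) => v 2) e
    simp [fmap] at e0 e1 e2
    have hx := sph_norm x
    have hy := sph_norm y
    refine ⟨⟨?_, ?_⟩, Complex.ext e1 e2⟩
    · rw [← sq_eq_sq₀ (norm_nonneg _) (norm_nonneg _)]; linarith
    · rw [← sq_eq_sq₀ (norm_nonneg _) (norm_nonneg _)]; linarith
  · rintro ⟨⟨h1, h2⟩, h3⟩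
    apply Subtype.ext
    simp only [fmap, h1, h2, h3]

lemma fmap_surj (a b : ℤ) (hb : b ≠ 0) : Function.Surjective (fmap a b) := by
  rintro ⟨v, hv⟩
  have hn : v 0 ^ 2 + v 1 ^ 2 + v 2 ^ 2 = 1 := by
    rw [mem_sphere_zero_iff_norm] at hv
    have := EuclideanSpace.norm_sq_eq v
    rw [hv, Fin.sum_univ_three] at this
    simp only [Real.norm_eq_abs, sq_abs] at this
    linarith
  have hl : -1 ≤ v 0 := by nlinarith [sq_nonneg (v 1), sq_nonneg (v 2)]
  have hu : v 0 ≤ 1 := by nlinarith [sq_nonneg (v 1), sq_nonneg (v 2)]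
  obtain ⟨w, hw⟩ : ∃ w : ℂ, w = ⟨v 1, v 2⟩ := ⟨_, rfl⟩
  obtain ⟨d, hd⟩ := exists_polar w
  obtain ⟨c, hc⟩ := circle_root b hb d
  obtain ⟨p, hp⟩ : ∃ p, p = √((1 + v 0) / 2) := ⟨_, rfl⟩
  obtain ⟨q, hq⟩ : ∃ q, q = √((1 - v 0) / 2) := ⟨_, rfl⟩
  have hp0 : 0 ≤ p := hp ▸ Real.sqrt_nonneg _
  have hq0 : 0 ≤ q := hq ▸ Real.sqrt_nonneg _
  have hp2 : p ^ 2 = (1 + v 0) / 2 := by rw [hp, Real.sq_sqrt (by linarith)]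
  have hq2 : q ^ 2 = (1 - v 0) / 2 := by rw [hq, Real.sq_sqrt (by linarith)]
  have hwn : ‖w‖ = 2 * (p * q) := by
    rw [← sq_eq_sq₀ (norm_nonneg _) (by positivity), Complex.sq_norm, Complex.normSq_apply, hw]
    have : (2 * (p * q)) ^ 2 = 4 * (p ^ 2 * q ^ 2) := by ring
    rw [this, hp2, hq2]
    simp only
    nlinarith
  have n0 : ‖(p : ℂ) * c‖ = p := by rw [norm_mul, nc]; simp [abs_of_nonneg hp0]
  have n1 : ‖(q : ℂ) * (1 : Circle)‖ = q := by simp [abs_of_nonneg hq0]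
  have hW : wmap a b (p * c) (q * (1 : Circle)) = w := by
    rw [wmap, phi_polar _ _ hp0, phi_polar _ _ hq0, hc, hd, hwn]
    simp
    ring
  refine ⟨⟨!₂[(p : ℂ) * c, (q : ℂ) * (1 : Circle)], ?_⟩, ?_⟩
  · rw [mem_sphere_zero_iff_norm, ← sq_eq_sq₀ (norm_nonneg _) zero_le_one,
      EuclideanSpace.norm_sq_eq, Fin.sum_univ_two]
    change ‖(p : ℂ) * c‖ ^ 2 + ‖(q : ℂ) * (1 : Circle)‖ ^ 2 = _
    rw [n0, n1, hp2, hq2]; ring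
  · apply Subtype.ext
    ext i
    fin_cases i
    · change ‖(p : ℂ) * c‖ ^ 2 - ‖(q : ℂ) * (1 : Circle)‖ ^ 2 = v 0
      rw [n0, n1, hp2, hq2]; ring
    · change (wmap a b (p * c) (q * (1 : Circle))).re = v 1
      rw [hW, hw]
    · change (wmap a b (p * c) (q * (1 : Circle))).im = v 2
      rw [hW, hw]

lemma weightProd_one (z : Fin 1 → Fin 2 → ℤ) (t : Fin 1 → Circle) (j : Fin 2) :
    weightProd z t j = t 0 ^ z 0 j := by
  simp [weightProd]

lemma orbit_iff (z : Fin 1 → Fin 2 → ℤ) (h1 : z 0 0 ≠ 0) (h2 : z 0 1 ≠ 0)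
    (g a b : ℤ) (ha : z 0 0 = a * g) (hb : z 0 1 = b * g) (hab : IsCoprime a b)
    (x y : Sph 2) : (orbitSetoid z) x y ↔ fmap a b x = fmap a b y := by
  have hg : g ≠ 0 := by rintro rfl; simp at ha; exact h1 ha
  rw [fmap_eq_iff]
  constructor
  · rintro ⟨t, ht⟩
    have e0 := ht 0
    have e1 := ht 1
    rw [weightProd_one] at e0 e1
    rw [← e0, ← e1, wmap_smul]
    refine ⟨⟨by rw [norm_mul, nc, one_mul], by rw [norm_mul, nc, one_mul]⟩, ?_⟩
    have : (t 0 ^ z 0 0) ^ b * (t 0 ^ z 0 1) ^ (-a) = 1 := by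
      rw [← zpow_mul, ← zpow_mul, ← zpow_add, ha, hb]
      have : a * g * b + b * g * -a = 0 := by ring
      rw [this, zpow_zero]
    rw [this]; simp
  · rintro ⟨⟨n0, n1⟩, hw⟩
    obtain ⟨c, hc⟩ := exists_circle n0
    obtain ⟨d, hd⟩ := exists_circle n1
    suffices h : ∃ t : Circle, ((t ^ z 0 0 : Circle) : ℂ) * x.1 0 = y.1 0 ∧
        ((t ^ z 0 1 : Circle) : ℂ) * x.1 1 = y.1 1 by
      obtain ⟨t, t0, t1⟩ := h
      refine ⟨fun _ => t, fun j => ?_⟩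
      rw [weightProd_one]
      fin_cases j
      · exact t0
      · exact t1
    by_cases x0 : x.1 0 = 0
    · obtain ⟨t, ht⟩ := circle_root _ h2 d
      refine ⟨t, ?_, by rw [ht, hd]⟩
      rw [← hc, x0]; simp
    by_cases x1 : x.1 1 = 0
    · obtain ⟨t, ht⟩ := circle_root _ h1 c
      refine ⟨t, by rw [ht, hc], ?_⟩
      rw [← hd, x1]; simp
    have hne : wmap a b (x.1 0) (x.1 1) ≠ 0 := by
      rw [← norm_pos_iff, norm_wmap]
      have := norm_pos_iff.2 x0
      have := norm_pos_iff.2 x1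
      positivity
    rw [← hc, ← hd, wmap_smul] at hw
    have hcd : c ^ b * d ^ (-a) = 1 := by
      apply Circle.ext
      have := mul_right_cancel₀ hne ((one_mul _).trans hw)
      rw [← this]; simp
    have hcd' : c ^ b = d ^ a := by
      rw [zpow_neg] at hcd
      exact mul_inv_eq_one.1 hcd
    obtain ⟨m, n, hmn⟩ := hab
    obtain ⟨t, ht⟩ := circle_root g hg (c ^ m * d ^ n)
    have ea : t ^ z 0 0 = c := by
      rw [ha, mul_comm, zpow_mul, ht, mul_zpow, ← zpow_mul, ← zpow_mul, mul_comm n a,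
        zpow_mul d a n, ← hcd', ← zpow_mul, ← zpow_add, mul_comm b n, hmn, zpow_one]
    have eb : t ^ z 0 1 = d := by
      rw [hb, mul_comm, zpow_mul, ht, mul_zpow, ← zpow_mul, ← zpow_mul, mul_comm m b,
        zpow_mul c b m, hcd', ← zpow_mul, ← zpow_add, mul_comm a m, hmn, zpow_one]
    exact ⟨t, by rw [ea, hc], by rw [eb, hd]⟩

/-- For `r = 1`, `n = 2` and weights `a₁, a₂ ≠ 0`, the orbit space of the
circle acting on `S³` with weights `a₁, a₂` is homeomorphic to the `2`-sphere. -/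
theorem orbitSpace_homeomorph_two_sphere (z : Fin 1 → Fin 2 → ℤ)
    (h1 : z 0 0 ≠ 0) (h2 : z 0 1 ≠ 0) :
    Nonempty (OrbitSpace z ≃ₜ Metric.sphere (0 : EuclideanSpace ℝ (Fin 3)) 1) := by
  obtain ⟨g, a, b, hab, ha, hb⟩ : ∃ g a b : ℤ, IsCoprime a b ∧ z 0 0 = a * g ∧ z 0 1 = b * g := by
    obtain ⟨a, b, hab, ha, hb⟩ := Int.exists_gcd_one (Int.gcd_pos_of_ne_zero_left (z 0 1) h1)
    exact ⟨_, a, b, Int.isCoprime_iff_gcd_eq_one.2 hab, ha, hb⟩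
  have hb0 : b ≠ 0 := by rintro rfl; simp at hb; exact h2 hb
  have key := orbit_iff z h1 h2 g a b ha hb hab
  let F : OrbitSpace z → Metric.sphere (0 : EuclideanSpace ℝ (Fin 3)) 1 :=
    Quotient.lift (fmap a b) (fun x y h => (key x y).1 h)
  have hF : Continuous F := (continuous_fmap a b).quotient_lift _
  have hbij : Function.Bijective F := by
    constructor
    · intro p q
      induction p using Quotient.inductionOn with | _ x
      induction q using Quotient.inductionOn with | _ y
      intro h
      exact Quotient.sound ((key x y).2 h)
    · intro v
      obtain ⟨x, hx⟩ := fmap_surj a b hb0 v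
      exact ⟨Quotient.mk _ x, hx⟩
  exact ⟨Continuous.homeoOfEquivCompactToT2 (f := Equiv.ofBijective F hbij) hF⟩
end
end

section
/- Let r = 1 and n ≥ 2, and suppose the weight vector a : Fin n → ℤ satisfies a j = c for all j ≠ j₀ and a j₀ = 1, for some index j₀ and some integer c ≥ 1. Then the orbit space X_a is homeomorphic to the orbit space of the standard scalar circle action (all weights equal to 1) on S^{2n−1}, i.e. X_a is homeomorphic to the complex projective space ℂP^{n−1}. -/
open scoped BigOperators

noncomputable section

/-- The norm-preserving power map. -/
def pw (m : ℕ) (w : ℂ) : ℂ := w ^ (m + 1) / ((‖w‖ : ℝ) : ℂ) ^ m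

theorem norm_pw (m : ℕ) (w : ℂ) : ‖pw m w‖ = ‖w‖ := by
  by_cases h : w = 0
  · simp [pw, h]
  · have h' : ‖w‖ ≠ 0 := by simpa using h
    simp only [pw, norm_div, norm_pow, Complex.norm_real, norm_norm]
    field_simp
    ring

theorem continuous_pw (m : ℕ) : Continuous (pw m) := by
  rw [continuous_iff_continuousAt]
  intro w
  by_cases h : w = 0
  · subst h
    have h0 : pw m 0 = 0 := by simp [pw]
    unfold ContinuousAt
    rw [h0, tendsto_zero_iff_norm_tendsto_zero]
    simp only [norm_pw]
    exact tendsto_norm_zero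
  · unfold pw
    apply ContinuousAt.div
    · fun_prop
    · fun_prop
    · simpa using fun h' => absurd h' h

theorem pw_surj (m : ℕ) (w : ℂ) : ∃ v, pw m v = w := by
  by_cases h : w = 0
  · exact ⟨0, by simp [pw, h]⟩
  · obtain ⟨v, hv⟩ := IsAlgClosed.exists_pow_nat_eq (w * ((‖w‖ : ℝ) : ℂ) ^ m) (Nat.succ_pos m)
    have hn : ‖v‖ ^ (m + 1) = ‖w‖ ^ (m + 1) := by
      have := congrArg norm hv
      simp only [norm_mul, norm_pow, Complex.norm_real, norm_norm] at this
      rw [Nat.succ_eq_add_one] at this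
      rw [this]; ring
    have hn' : ‖v‖ = ‖w‖ :=
      (pow_left_inj₀ (norm_nonneg _) (norm_nonneg _) (Nat.succ_ne_zero m)).1 hn
    refine ⟨v, ?_⟩
    have h' : ((‖w‖ : ℝ) : ℂ) ≠ 0 := by simpa using h
    unfold pw
    rw [hn', show v ^ (m + 1) = _ from hv]
    field_simp

theorem pw_circle (m : ℕ) (t : Circle) (w : ℂ) :
    pw m ((t : ℂ) * w) = ((t ^ (m + 1) : Circle) : ℂ) * pw m w := by
  simp [pw, mul_pow, mul_div_assoc, Circle.norm_coe]

theorem circle_root_s5 (m : ℕ) (s : Circle) : ∃ t : Circle, t ^ (m + 1) = s := by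
  obtain ⟨v, hv⟩ := IsAlgClosed.exists_pow_nat_eq (s : ℂ) (Nat.succ_pos m)
  have hn : ‖v‖ = 1 := by
    have := congrArg norm hv
    simp only [norm_pow, Circle.norm_coe] at this
    exact (pow_eq_one_iff_of_nonneg (norm_nonneg _) (Nat.succ_ne_zero m)).1 this
  obtain ⟨t, rfl⟩ : ∃ t : Circle, (t : ℂ) = v := ⟨⟨v, mem_sphere_zero_iff_norm.2 hn⟩, rfl⟩
  refine ⟨t, ?_⟩
  apply Circle.ext
  rw [Circle.coe_pow]
  exact hv

theorem pw_inj (m : ℕ) (s : Circle) (x y : ℂ) (h : (s : ℂ) * pw m x = pw m y) :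
    ∃ t : Circle, t ^ (m + 1) = s ∧ (t : ℂ) * x = y := by
  have hn : ‖x‖ = ‖y‖ := by
    have := congrArg norm h
    simpa [norm_pw, Circle.norm_coe] using this
  by_cases hx : x = 0
  · obtain ⟨t, ht⟩ := circle_root_s5 m s
    refine ⟨t, ht, ?_⟩
    subst hx
    simp only [norm_zero] at hn
    have : y = 0 := norm_eq_zero.1 hn.symm
    simp [this]
  · have hx' : ‖x‖ ≠ 0 := by simpa using hx
    have hx2 : ((‖x‖ : ℝ) : ℂ) ≠ 0 := by simpa using hx
    have h1 : ‖y / x‖ = 1 := by rw [norm_div, ← hn, div_self hx']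
    obtain ⟨t, ht⟩ : ∃ t : Circle, (t : ℂ) = y / x := ⟨⟨_, mem_sphere_zero_iff_norm.2 h1⟩, rfl⟩
    refine ⟨t, ?_, ?_⟩
    · apply Circle.ext
      rw [Circle.coe_pow, ht]
      unfold pw at h
      rw [← hn] at h
      rw [div_pow, div_eq_iff (pow_ne_zero _ hx)]
      field_simp at h
      exact h.symm
    · rw [ht]; exact div_mul_cancel₀ y hx

/-- The ambient map: apply `pw` at the coordinate `j₀`. -/
def ambMap {n : ℕ} (m : ℕ) (j₀ : Fin n) (x : EuclideanSpace ℂ (Fin n)) :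
    EuclideanSpace ℂ (Fin n) :=
  WithLp.toLp 2 fun j => if j = j₀ then pw m (x j) else x j

theorem norm_ambMap {n : ℕ} (m : ℕ) (j₀ : Fin n) (x : EuclideanSpace ℂ (Fin n)) :
    ‖ambMap m j₀ x‖ = ‖x‖ := by
  rw [EuclideanSpace.norm_eq, EuclideanSpace.norm_eq]
  congr 1
  apply Finset.sum_congr rfl
  intro j _
  by_cases h : j = j₀ <;> simp [ambMap, h, norm_pw]

/-- The induced map of spheres. -/
def sphMap {n : ℕ} (m : ℕ) (j₀ : Fin n) (x : Sph n) : Sph n :=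
  ⟨ambMap m j₀ x, by
    rw [mem_sphere_zero_iff_norm, norm_ambMap]; exact mem_sphere_zero_iff_norm.1 x.2⟩

theorem continuous_sphMap {n : ℕ} (m : ℕ) (j₀ : Fin n) : Continuous (sphMap m j₀) := by
  apply Continuous.subtype_mk
  unfold ambMap
  apply (PiLp.continuous_toLp 2 _).comp
  apply continuous_pi
  intro j
  have hc : Continuous fun x : Sph n => (x : EuclideanSpace ℂ (Fin n)) j := by fun_prop
  by_cases h : j = j₀
  · simp only [h, if_true]
    subst h
    exact (continuous_pw m).comp hc
  · simp only [h, if_false]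
    exact hc

theorem sphMap_surj {n : ℕ} (m : ℕ) (j₀ : Fin n) : Function.Surjective (sphMap m j₀) := by
  intro y
  obtain ⟨v, hv⟩ := pw_surj m ((y : EuclideanSpace ℂ (Fin n)) j₀)
  let x : EuclideanSpace ℂ (Fin n) :=
    WithLp.toLp 2 fun j => if j = j₀ then v else (y : EuclideanSpace ℂ (Fin n)) j
  have hx : ambMap m j₀ x = y := by
    ext j
    by_cases h : j = j₀
    · subst h
      simp [ambMap, x, hv]
    · simp [ambMap, x, h]
  refine ⟨⟨x, ?_⟩, Subtype.ext hx⟩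
  rw [mem_sphere_zero_iff_norm, ← norm_ambMap m j₀, hx]
  exact mem_sphere_zero_iff_norm.1 y.2

/-- Let `r = 1`, `n ≥ 2`, and suppose the weight vector `a` has `a j = c`
for all `j ≠ j₀` and `a j₀ = 1`, where `c ≥ 1`.  Then `X_a` is homeomorphic to the orbit
space of the standard scalar circle action (all weights `1`) on `S^{2n-1}`, i.e. to the
complex projective space `ℂP^{n-1}`. -/
theorem orbitSpace_weighted_homeomorph_CPn (n : ℕ) (hn : 2 ≤ n) (a : Fin n → ℤ)
    (j₀ : Fin n) (c : ℤ) (hc : 1 ≤ c) (hj₀ : a j₀ = 1) (hrest : ∀ j, j ≠ j₀ → a j = c) :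
    Nonempty (OrbitSpace (fun _ : Fin 1 => a) ≃ₜ
      OrbitSpace (fun _ : Fin 1 => fun _ : Fin n => (1 : ℤ))) := by
  obtain ⟨m, rfl⟩ : ∃ m : ℕ, c = ((m + 1 : ℕ) : ℤ) := ⟨(c - 1).toNat, by omega⟩
  set Z : Fin 1 → Fin n → ℤ := fun _ => fun _ => 1
  have hq : Topology.IsQuotientMap (sphMap m j₀ : Sph n → Sph n) :=
    (continuous_sphMap m j₀).isClosedMap.isQuotientMap (continuous_sphMap m j₀) (sphMap_surj m j₀)
  have hq2 : Topology.IsQuotientMap (Quotient.mk (orbitSetoid Z) ∘ sphMap m j₀) :=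
    isQuotientMap_quotient_mk'.comp hq
  have hker : orbitSetoid (fun _ : Fin 1 => a) =
      Setoid.ker (Quotient.mk (orbitSetoid Z) ∘ sphMap m j₀) := by
    ext x y
    rw [Setoid.ker_def, Function.comp_apply, Function.comp_apply, Quotient.eq]
    constructor
    · rintro ⟨t, ht⟩
      refine ⟨fun i => t i ^ (m + 1), fun j => ?_⟩
      have := ht j
      by_cases h : j = j₀
      · subst h
        simp only [weightProd, Finset.univ_unique, Finset.prod_singleton, hj₀, zpow_one] at this
        simp only [Z, weightProd, Finset.univ_unique, Finset.prod_singleton, zpow_one, sphMap,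
          ambMap, if_true]
        rw [← this, pw_circle]
      · simp only [weightProd, Finset.univ_unique, Finset.prod_singleton, hrest j h,
          zpow_natCast] at this
        simp only [Z, weightProd, Finset.univ_unique, Finset.prod_singleton, zpow_one, sphMap,
          ambMap, if_neg h]
        exact this
    · rintro ⟨s, hs⟩
      have h0 := hs j₀
      simp only [Z, weightProd, Finset.univ_unique, Finset.prod_singleton, zpow_one, sphMap,
          ambMap, if_true] at h0
      obtain ⟨t, ht, hxy⟩ := pw_inj m _ _ _ h0
      refine ⟨fun _ => t, fun j => ?_⟩
      by_cases h : j = j₀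
      · subst h
        simp only [weightProd, Finset.univ_unique, Finset.prod_singleton, hj₀, zpow_one]
        exact hxy
      · have := hs j
        simp only [Z, weightProd, Finset.univ_unique, Finset.prod_singleton, zpow_one, sphMap,
          ambMap, if_neg h] at this
        simp only [weightProd, Finset.univ_unique, Finset.prod_singleton, hrest j h,
          zpow_natCast]
        rw [ht]
        exact this
  unfold OrbitSpace
  rw [hker]
  exact ⟨Topology.IsQuotientMap.homeomorph (f := ⟨_, hq2.continuous⟩) hq2⟩
end
end

section
/- Suppose the columns of z generate ℤ^r (effective action) and there is a partition of Fin n into nonempty blocks B₁, …, B_l such that for each k the set of columns {(i ↦ (z i j : ℚ)) | j ∈ B_k} is minimally dependent over ℚ (a circuit), and r = n − l (so the column matroid of z is a direct sum of circuits). Then the orbit space X_z is homeomorphic to the sphere of dimension 2n − 1 − r, i.e. to Metric.sphere (0 : EuclideanSpace ℝ (Fin (2n − r))) 1. -/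
open scoped BigOperators

noncomputable section

/-- The set of columns of `z` indexed by `B` is minimally dependent over `ℚ` (a circuit):
it is ℚ-linearly dependent, but every proper subset of it is ℚ-linearly independent. -/
def IsCircuitOfCols {n r : ℕ} (z : Fin r → Fin n → ℤ) (B : Finset (Fin n)) : Prop :=
  ¬ LinearIndependent ℚ (fun j : B => fun i => (z i (j : Fin n) : ℚ)) ∧
    ∀ C : Finset (Fin n), C ⊂ B →
      LinearIndependent ℚ (fun j : C => fun i => (z i (j : Fin n) : ℚ))

/-- The column matroid of `z` is a direct sum of circuits: `Fin n` can be partitioned into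
nonempty blocks, each of which indexes a circuit of columns, with `r = n - l` where `l` is
the number of blocks. -/
def IsSumOfCircuits {n r : ℕ} (z : Fin r → Fin n → ℤ) : Prop :=
  ∃ (l : ℕ) (B : Fin l → Finset (Fin n)),
    (∀ k, (B k).Nonempty) ∧ (∀ k, IsCircuitOfCols z (B k)) ∧
    (∀ k k', k ≠ k' → Disjoint (B k) (B k')) ∧ (∀ j, ∃ k, j ∈ B k) ∧ r = n - l

theorem sc_algebra (n r : ℕ)
    (z : Fin r → Fin n → ℤ)
    (heff : ∀ v : Fin r → ℤ, ∃ c : Fin n → ℤ, ∀ i, ∑ j, c j * z i j = v i)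
    (hsum : IsSumOfCircuits z) :
    ∃ (l : ℕ) (κ : Fin n → Fin l) (b : Fin l → Fin n) (d : Fin n → ℤ),
      (∀ k, κ (b k) = k) ∧ (∀ j, d j ≠ 0) ∧ r + l = n ∧
      (∀ k i, ∑ j with κ j = k, d j * z i j = 0) ∧
      (∀ c : Fin n → ℤ, (∀ i, ∑ j, c j * z i j = 0) →
        ∃ q : Fin l → ℤ, ∀ j, c j = q (κ j) * d j) := by
  classical
  obtain ⟨l, B, hne, hcirc, hdisj, hcov, hr⟩ := hsum
  choose κ hκ using hcov
  choose b hb using hne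
  have hκiff : ∀ j k, j ∈ B k → κ j = k := by
    intro j k hj
    by_contra h
    exact (Finset.disjoint_left.mp (hdisj _ _ h) (hκ j)) hj
  have hκB : ∀ k, (Finset.univ.filter fun j => κ j = k) = B k := by
    intro k; ext j
    simp only [Finset.mem_filter, Finset.mem_univ, true_and]
    exact ⟨fun h => h ▸ hκ j, hκiff j k⟩
  have hκb : ∀ k, κ (b k) = k := fun k => hκiff _ _ (hb k)
  have hln : l ≤ n := by
    have : Function.Injective b := Function.LeftInverse.injective hκb
    simpa using Fintype.card_le_of_injective b this
  have hrl : r + l = n := by omega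
  let A : Fin l → Submodule ℤ (Fin n → ℤ) := fun k =>
    { carrier := {c | (∀ j, κ j ≠ k → c j = 0) ∧ ∀ i, ∑ j, c j * z i j = 0}
      zero_mem' := by simp
      add_mem' := by
        rintro a c ⟨h1, h2⟩ ⟨h3, h4⟩
        refine ⟨fun j hj => by simp [h1 j hj, h3 j hj], fun i => ?_⟩
        simp [add_mul, Finset.sum_add_distrib, h2, h4]
      smul_mem' := by
        rintro a c ⟨h1, h2⟩
        refine ⟨fun j hj => by simp [h1 j hj], fun i => ?_⟩
        simp [mul_assoc, ← Finset.mul_sum, h2] }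
  have hA : ∀ k c, c ∈ A k ↔ (∀ j, κ j ≠ k → c j = 0) ∧ ∀ i, ∑ j, c j * z i j = 0 :=
    fun k c => Iff.rfl
  -- uniqueness
  have huniq : ∀ k c, c ∈ A k → ∀ j, κ j = k → c j = 0 → c = 0 := by
    intro k c hc j hj hcj
    obtain ⟨h1, h2⟩ := (hA k c).1 hc
    have hjB : j ∈ B k := hj ▸ hκ j
    have hli := (hcirc k).2 ((B k).erase j) (Finset.erase_ssubset hjB)
    rw [← LinearIndependent.iff_fractionRing ℤ ℚ] at hli
    rw [Fintype.linearIndependent_iff] at hli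
    have hz : ∀ x, x ∉ (B k).erase j → c x = 0 := by
      intro x hx
      by_cases hxj : x = j
      · rw [hxj, hcj]
      · apply h1; intro hxk; apply hx
        rw [Finset.mem_erase]; exact ⟨hxj, hxk ▸ hκ x⟩
    have := hli (fun x => c x) (by
      ext i
      have h3 := h2 i
      rw [← Finset.sum_subset (Finset.subset_univ ((B k).erase j))
        (fun x _ hx => by rw [hz x hx, zero_mul])] at h3
      rw [← Finset.sum_coe_sort] at h3
      simp only [Finset.sum_apply, zsmul_eq_mul, Pi.zero_apply, Pi.mul_apply, Pi.intCast_apply]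
      exact_mod_cast h3)
    ext x
    by_cases hx : x ∈ (B k).erase j
    · exact this ⟨x, hx⟩
    · exact hz x hx
  have hex : ∀ k, ∃ c ∈ A k, c ≠ 0 := by
    intro k
    have hli := (hcirc k).1
    rw [← LinearIndependent.iff_fractionRing ℤ ℚ] at hli
    rw [Fintype.not_linearIndependent_iff] at hli
    obtain ⟨g, hg, x, hx⟩ := hli
    refine ⟨fun j => if h : j ∈ B k then g ⟨j, h⟩ else 0, ?_, ?_⟩
    · rw [hA]
      refine ⟨fun j hj => ?_, fun i => ?_⟩
      · rw [dif_neg]; exact fun h => hj (hκiff _ _ h)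
      · rw [← Finset.sum_subset (Finset.subset_univ (B k))
          (fun x _ hx => by rw [dif_neg hx, zero_mul])]
        rw [← Finset.sum_coe_sort]
        have := congrFun hg i
        simp only [Finset.sum_apply, zsmul_eq_mul, Pi.zero_apply, Pi.mul_apply, Pi.intCast_apply] at this
        simp only [Finset.coe_mem, dif_pos]
        exact_mod_cast this
    · intro h
      have := congrFun h x
      simp at this
      exact hx this
  have hgen : ∀ k, ∃ D ∈ A k, D ≠ 0 ∧ ∀ c ∈ A k, ∃ a : ℤ, c = a • D := by
    intro k
    let I : Submodule ℤ ℤ := (A k).map (LinearMap.proj (b k))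
    have hP : I.IsPrincipal := inferInstance
    have hg := Submodule.IsPrincipal.generator_mem I
    obtain ⟨D, hD, hDg⟩ := hg
    have key : ∀ c ∈ A k, ∃ a : ℤ, c = a • D := by
      intro c hc
      have hcI : c (b k) ∈ I := ⟨c, hc, rfl⟩
      obtain ⟨a, ha⟩ := (Submodule.IsPrincipal.mem_iff_eq_smul_generator I).1 hcI
      refine ⟨a, ?_⟩
      rw [← hDg] at ha
      have := huniq k (c - a • D) ((A k).sub_mem hc ((A k).smul_mem a hD)) (b k) (hκb k) (by
        simp only [LinearMap.proj_apply] at ha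
        simp [ha])
      exact sub_eq_zero.1 this
    refine ⟨D, hD, ?_, key⟩
    rintro rfl
    obtain ⟨c, hc, hc0⟩ := hex k
    obtain ⟨a, ha⟩ := key c hc
    exact hc0 (by simpa using ha)
  choose D hDA hD0 hDgen using hgen
  have hDz : ∀ k i, ∑ j with κ j = k, D (κ j) j * z i j = 0 := by
    intro k i
    obtain ⟨h1, h2⟩ := (hA k _).1 (hDA k)
    rw [← h2 i]
    rw [← Finset.sum_subset (Finset.subset_univ (Finset.univ.filter fun j => κ j = k))
      (fun x _ hx => by rw [h1 x (by simpa using hx), zero_mul])]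
    apply Finset.sum_congr rfl
    intro j hj
    rw [(Finset.mem_filter.1 hj).2]
  have hd0 : ∀ j, D (κ j) j ≠ 0 := fun j h => hD0 (κ j) (huniq _ _ (hDA _) j rfl h)
  refine ⟨l, κ, b, fun j => D (κ j) j, hκb, hd0, hrl, hDz, ?_⟩
  intro c hc
  -- rational dimension count
  let L : (Fin n → ℚ) →ₗ[ℚ] (Fin r → ℚ) := (Matrix.of fun i j => (z i j : ℚ)).mulVecLin
  have hL : ∀ x i, L x i = ∑ j, (z i j : ℚ) * x j := fun x i => rfl
  have hLs : Function.Surjective L := by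
    intro v
    choose σ hσ using fun i : Fin r => heff (Pi.single i 1)
    refine ⟨fun j => ∑ i, v i * (σ i j : ℚ), ?_⟩
    ext i
    rw [hL]
    simp_rw [Finset.mul_sum]
    rw [Finset.sum_comm]
    have : ∀ i', ∑ j, (z i j : ℚ) * (v i' * (σ i' j : ℚ)) = v i' * ((Pi.single i' (1 : ℤ) : Fin r → ℤ) i : ℤ) := by
      intro i'
      rw [← hσ i' i]
      push_cast
      rw [Finset.mul_sum]
      exact Finset.sum_congr rfl fun j _ => by ring
    simp_rw [this]
    rw [Finset.sum_eq_single i]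
    · simp
    · intro i' _ h
      rw [Pi.single_eq_of_ne (Ne.symm h)]; simp
    · simp
  have hfr : Module.finrank ℚ (LinearMap.ker L) = l := by
    have := LinearMap.finrank_range_add_finrank_ker L
    rw [LinearMap.range_eq_top.2 hLs] at this
    simp at this
    omega
  let G0 : (Fin l → ℚ) →ₗ[ℚ] (Fin n → ℚ) :=
    { toFun := fun q j => q (κ j) * (D (κ j) j : ℚ)
      map_add' := by intro x y; ext j; simp [add_mul]
      map_smul' := by intro a x; ext j; simp [mul_assoc] }
  have hG0 : ∀ q, G0 q ∈ LinearMap.ker L := by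
    intro q
    rw [LinearMap.mem_ker]
    ext i
    rw [hL, ← Finset.sum_fiberwise Finset.univ κ]
    apply Finset.sum_eq_zero
    intro k _
    have h := hDz k i
    have h' : ∑ j with κ j = k, (D (κ j) j : ℚ) * (z i j : ℚ) = 0 := by exact_mod_cast h
    calc _ = ∑ j with κ j = k, q k * ((D (κ j) j : ℚ) * (z i j : ℚ)) := by
          apply Finset.sum_congr rfl
          intro j hj
          have := (Finset.mem_filter.1 hj).2
          change (z i j : ℚ) * (q (κ j) * (D (κ j) j : ℚ)) = _
          rw [this]; ring
      _ = 0 := by rw [← Finset.mul_sum, h', mul_zero]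
  let G : (Fin l → ℚ) →ₗ[ℚ] LinearMap.ker L := G0.codRestrict _ hG0
  have hGi : Function.Injective G := by
    rw [← LinearMap.ker_eq_bot, LinearMap.ker_eq_bot']
    intro q hq
    ext k
    have h1 : G0 q = 0 := congrArg Subtype.val hq
    have h2 : q (κ (b k)) * (D (κ (b k)) (b k) : ℚ) = 0 := congrFun h1 (b k)
    rcases mul_eq_zero.1 h2 with h | h
    · rwa [hκb] at h
    · exact absurd (by exact_mod_cast h) (hd0 (b k))
  have hGs : Function.Surjective G :=
    (LinearMap.injective_iff_surjective_of_finrank_eq_finrank (by simp [hfr])).1 hGi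
  obtain ⟨q, hq⟩ := hGs ⟨fun j => (c j : ℚ), by
    rw [LinearMap.mem_ker]; ext i; rw [hL]
    have := hc i
    have h5 : ∑ j, z i j * c j = 0 := by
      rw [← this]; exact Finset.sum_congr rfl fun j _ => mul_comm _ _
    rw [Pi.zero_apply]
    exact_mod_cast h5⟩
  have hq' : ∀ j, q (κ j) * (D (κ j) j : ℚ) = c j := fun j => congrFun (congrArg Subtype.val hq) j
  have hres : ∀ k, (fun j => if κ j = k then c j else 0) ∈ A k := by
    intro k
    rw [hA]
    refine ⟨fun j hj => by simp [hj], fun i => ?_⟩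
    simp only [ite_mul, zero_mul]
    rw [← Finset.sum_filter]
    have h := hDz k i
    have h' : ∑ j with κ j = k, (D (κ j) j : ℚ) * (z i j : ℚ) = 0 := by exact_mod_cast h
    have : ∑ j with κ j = k, (c j : ℚ) * (z i j : ℚ) = 0 := by
      calc _ = ∑ j with κ j = k, q k * ((D (κ j) j : ℚ) * (z i j : ℚ)) := by
            apply Finset.sum_congr rfl
            intro j hj
            have := (Finset.mem_filter.1 hj).2
            rw [← hq' j, this]; ring
        _ = 0 := by rw [← Finset.mul_sum, h', mul_zero]
    exact_mod_cast this
  choose a ha using fun k => hDgen k _ (hres k)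
  refine ⟨a, fun j => ?_⟩
  have := congrFun (ha (κ j)) j
  simpa using this

theorem sc_prod_zpow {ι : Type*} (S : Finset ι) (f : ι → ℤ) (a : Circle) :
    ∏ i ∈ S, a ^ f i = a ^ ∑ i ∈ S, f i := by
  classical
  induction S using Finset.induction_on with
  | empty => simp
  | insert x S hx ih => rw [Finset.prod_insert hx, Finset.sum_insert hx, ih, zpow_add]

theorem sc_span (n r : ℕ) (z : Fin r → Fin n → ℤ)
    (heff : Submodule.span ℤ (Set.range fun j => fun i => z i j) = ⊤) :
    ∀ v : Fin r → ℤ, ∃ c : Fin n → ℤ, ∀ i, ∑ j, c j * z i j = v i := by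
  intro v
  have : v ∈ Submodule.span ℤ (Set.range fun j => fun i => z i j) := by rw [heff]; trivial
  obtain ⟨c, hc⟩ := (Submodule.mem_span_range_iff_exists_fun ℤ).1 this
  refine ⟨c, fun i => ?_⟩
  rw [← hc]; simp

theorem sc_image (n r l : ℕ) (z : Fin r → Fin n → ℤ)
    (heff : ∀ v : Fin r → ℤ, ∃ c : Fin n → ℤ, ∀ i, ∑ j, c j * z i j = v i)
    (κ : Fin n → Fin l) (d : Fin n → ℤ)
    (h1 : ∀ k i, ∑ j with κ j = k, d j * z i j = 0)
    (h2 : ∀ c : Fin n → ℤ, (∀ i, ∑ j, c j * z i j = 0) →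
        ∃ q : Fin l → ℤ, ∀ j, c j = q (κ j) * d j) (s : Fin n → Circle) :
    (∃ t : Fin r → Circle, ∀ j, weightProd z t j = s j) ↔
      ∀ k, ∏ j with κ j = k, s j ^ d j = 1 := by
  constructor
  · rintro ⟨t, ht⟩ k
    simp_rw [← ht, weightProd, ← Finset.prod_zpow, ← zpow_mul]
    rw [Finset.prod_comm]
    apply Finset.prod_eq_one
    intro i _
    rw [sc_prod_zpow, ← zpow_zero (t i), ← h1 k i]
    congr 1
    exact Finset.sum_congr rfl fun j _ => mul_comm _ _
  · intro h
    choose σ hσ using fun i : Fin r => heff (Pi.single i 1)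
    have hK : ∀ c : Fin n → ℤ, (∀ i, ∑ j, c j * z i j = 0) → ∏ j, s j ^ c j = 1 := by
      intro c hc
      obtain ⟨q, hq⟩ := h2 c hc
      rw [← Finset.prod_fiberwise Finset.univ κ]
      apply Finset.prod_eq_one
      intro k _
      rw [← one_zpow (q k), ← h k, ← Finset.prod_zpow]
      apply Finset.prod_congr rfl
      intro j hj
      rw [hq j, (Finset.mem_filter.1 hj).2, ← zpow_mul, mul_comm]
    refine ⟨fun i => ∏ j, s j ^ σ i j, fun j => ?_⟩
    have h3 := hK (fun m => (∑ i, σ i m * z i j) - (Pi.single j (1 : ℤ) : Fin n → ℤ) m) (by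
      intro i
      simp only [sub_mul, Finset.sum_sub_distrib, Finset.sum_mul]
      rw [Finset.sum_comm]
      have : ∀ i', ∑ m, σ i' m * z i' j * z i m = z i' j * (Pi.single i' (1 : ℤ) : Fin r → ℤ) i := by
        intro i'
        rw [← hσ i' i, Finset.mul_sum]
        exact Finset.sum_congr rfl fun j _ => by ring
      simp_rw [this]
      simp [Pi.single_apply])
    simp_rw [zpow_sub, Finset.prod_mul_distrib] at h3
    rw [Finset.prod_inv_distrib, mul_inv_eq_one] at h3
    have h4 : ∏ m, s m ^ (Pi.single j (1 : ℤ) : Fin n → ℤ) m = s j := by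
      rw [Finset.prod_eq_single j]
      · simp
      · intro m _ hm
        rw [Pi.single_eq_of_ne hm]; simp
      · simp
    rw [h4] at h3
    rw [← h3]
    simp_rw [weightProd, ← Finset.prod_zpow, ← zpow_mul]
    rw [Finset.prod_comm]
    exact Finset.prod_congr rfl fun m _ => sc_prod_zpow _ _ _

theorem sc_inducing : Topology.IsInducing (fun c : Circle => (c : ℂ)) :=
  ⟨rfl⟩

/-- phase -/
def scPhase (x : ℂ) : Circle := Circle.exp (Complex.arg x)

theorem scPhase_mul (x : ℂ) : (‖x‖ : ℂ) * (scPhase x : ℂ) = x := by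
  rw [scPhase, Circle.coe_exp, Complex.norm_mul_exp_arg_mul_I]

theorem scPhase_eq {a : ℝ} (ha : 0 < a) (ρ : Circle) : scPhase ((a : ℂ) * ρ) = ρ := by
  rw [scPhase, Complex.arg_real_mul _ ha, Circle.exp_arg]

theorem scPhase_circle_mul {x : ℂ} (hx : x ≠ 0) (s : Circle) :
    scPhase ((s : ℂ) * x) = s * scPhase x := by
  have h : (s : ℂ) * x = ((‖x‖ : ℝ) : ℂ) * ((s * scPhase x : Circle) : ℂ) := by
    conv_lhs => rw [← scPhase_mul x]
    push_cast; ring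
  rw [h, scPhase_eq (norm_pos_iff.2 hx)]

theorem scPhase_real_mul {a : ℝ} (ha : 0 < a) (x : ℂ) :
    scPhase ((a : ℂ) * x) = scPhase x := by
  rw [scPhase, scPhase, Complex.arg_real_mul _ ha]

theorem scPhase_continuousAt {x : ℂ} (hx : x ≠ 0) : ContinuousAt scPhase x := by
  rw [ContinuousAt, sc_inducing.tendsto_nhds_iff]
  have h : ∀ y : ℂ, y ≠ 0 → (scPhase y : ℂ) = y / ‖y‖ := by
    intro y hy
    have hy' : (‖y‖ : ℂ) ≠ 0 := by simpa using hy
    rw [eq_div_iff hy', mul_comm, scPhase_mul]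
  have hc : ContinuousAt (fun y : ℂ => y / (‖y‖ : ℂ)) x := by
    apply ContinuousAt.div continuousAt_id
    · exact (Complex.continuous_ofReal.comp continuous_norm).continuousAt
    · simpa using hx
  have : (fun y : ℂ => y / (‖y‖ : ℂ)) =ᶠ[nhds x] fun y => (scPhase y : ℂ) := by
    filter_upwards [isOpen_ne.mem_nhds hx] with y hy
    exact (h y hy).symm
  have h3 := hc.congr this
  exact h3

theorem sc_root (d : ℤ) (hd : d ≠ 0) (a : Circle) : ∃ ρ : Circle, ρ ^ d = a := by
  refine ⟨Circle.exp (Complex.arg a / d), ?_⟩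
  rw [← Circle.exp_zsmul, zsmul_eq_mul, mul_div_cancel₀ _ (by exact_mod_cast hd), Circle.exp_arg]

section scF
variable {n l : ℕ} (κ : Fin n → Fin l) (b : Fin l → Fin n) (d : Fin n → ℤ)
  (hb : ∀ k, κ (b k) = k)

theorem scBlock_ne (hb : ∀ k, κ (b k) = k) (k : Fin l) :
    (Finset.univ.filter fun j => κ j = k).Nonempty := ⟨b k, by simp [hb]⟩

/-- block minimum -/
def scMin (a : Fin n → ℝ) (k : Fin l) : ℝ :=
  (Finset.univ.filter fun j => κ j = k).inf' (scBlock_ne κ b hb k) a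

theorem scMin_le (a : Fin n → ℝ) (j : Fin n) : scMin κ b hb a (κ j) ≤ a j :=
  Finset.inf'_le _ (by simp)

theorem scMin_exists (a : Fin n → ℝ) (k : Fin l) : ∃ j, κ j = k ∧ scMin κ b hb a k = a j := by
  obtain ⟨j, hj, h⟩ := Finset.exists_mem_eq_inf' (scBlock_ne κ b hb k) a
  exact ⟨j, by simpa using hj, h⟩

theorem scMin_eq {a : Fin n → ℝ} {k : Fin l} {m : ℝ} (h1 : ∀ j, κ j = k → m ≤ a j)
    (h2 : ∃ j, κ j = k ∧ a j = m) : scMin κ b hb a k = m := by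
  apply le_antisymm
  · obtain ⟨j, rfl, rfl⟩ := h2
    exact scMin_le κ b hb a j
  · obtain ⟨j, hj, h⟩ := scMin_exists κ b hb a k
    rw [h]; exact h1 j hj

/-- phase product -/
def scProd (x : Fin n → ℂ) (k : Fin l) : Circle := ∏ j with κ j = k, scPhase (x j) ^ d j

/-- second component -/
def scW (x : Fin n → ℂ) (k : Fin l) : ℂ :=
  (scMin κ b hb (fun j => ‖x j‖) k : ℂ) * (scProd κ d x k : ℂ)

/-- target space -/
abbrev ScE : Type := ({j : Fin n // b (κ j) ≠ j} → ℝ) × (Fin l → ℂ)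

/-- the invariant map -/
def scF (x : Fin n → ℂ) : ScE κ b :=
  (fun j => ‖x j‖ - ‖x (b (κ j))‖, fun k => scW κ b d hb x k)

theorem scMin_nonneg (x : Fin n → ℂ) (k : Fin l) : 0 ≤ scMin κ b hb (fun j => ‖x j‖) k := by
  obtain ⟨j, -, h⟩ := scMin_exists κ b hb (fun j => ‖x j‖) k
  rw [h]; exact norm_nonneg _

theorem scW_norm (x : Fin n → ℂ) (k : Fin l) :
    ‖scW κ b d hb x k‖ = scMin κ b hb (fun j => ‖x j‖) k := by
  rw [scW, norm_mul, Circle.norm_coe, mul_one, Complex.norm_real, Real.norm_eq_abs,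
    abs_of_nonneg (scMin_nonneg κ b hb x k)]

theorem scMin_continuous (k : Fin l) :
    Continuous fun x : Fin n → ℂ => scMin κ b hb (fun j => ‖x j‖) k := by
  unfold scMin
  apply Continuous.finset_inf'_apply
  intro j _
  exact continuous_norm.comp (continuous_apply j)

theorem scW_continuous (k : Fin l) : Continuous fun x : Fin n → ℂ => scW κ b d hb x k := by
  rw [continuous_iff_continuousAt]
  intro x
  by_cases h : scMin κ b hb (fun j => ‖x j‖) k = 0
  · have h0 : scW κ b d hb x k = 0 := by rw [scW, h]; simp
    rw [ContinuousAt, h0, tendsto_zero_iff_norm_tendsto_zero]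
    simp_rw [scW_norm]
    rw [← h]
    exact (scMin_continuous κ b hb k).continuousAt
  · have hne : ∀ j, κ j = k → x j ≠ 0 := by
      rintro j rfl hj
      apply h
      apply le_antisymm _ (scMin_nonneg κ b hb x _)
      have := scMin_le κ b hb (fun j => ‖x j‖) j
      simpa [hj] using this
    unfold scW
    apply ContinuousAt.mul
    · exact (Complex.continuous_ofReal.comp (scMin_continuous κ b hb k)).continuousAt
    · refine ContinuousAt.comp (g := fun c : Circle => (c : ℂ))
        sc_inducing.continuous.continuousAt ?_
      unfold scProd
      apply tendsto_finsetProd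
      intro j hj
      apply ContinuousAt.zpow
      refine ContinuousAt.comp (g := scPhase) (scPhase_continuousAt ?_)
        (continuous_apply j).continuousAt
      exact hne j (by simpa using hj)

theorem scF_continuous : Continuous (scF κ b d hb) := by
  unfold scF
  refine Continuous.prodMk (continuous_pi fun j => ?_) (continuous_pi fun k => ?_)
  · exact (continuous_norm.comp (continuous_apply _)).sub (continuous_norm.comp (continuous_apply _))
  · exact scW_continuous κ b d hb k

theorem scF_smul {a : ℝ} (ha : 0 < a) (x : Fin n → ℂ) :
    scF κ b d hb (fun j => (a : ℂ) * x j) = a • scF κ b d hb x := by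
  have hm : ∀ k, scMin κ b hb (fun j => ‖(a : ℂ) * x j‖) k
      = a * scMin κ b hb (fun j => ‖x j‖) k := by
    intro k
    apply scMin_eq
    · rintro j rfl
      rw [norm_mul, Complex.norm_real, Real.norm_eq_abs, abs_of_pos ha]
      exact mul_le_mul_of_nonneg_left (scMin_le κ b hb (fun j => ‖x j‖) j) ha.le
    · obtain ⟨j, hj, h⟩ := scMin_exists κ b hb (fun j => ‖x j‖) k
      refine ⟨j, hj, ?_⟩
      rw [h, norm_mul, Complex.norm_real, Real.norm_eq_abs, abs_of_pos ha]
  ext j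
  · simp [scF, abs_of_pos ha, mul_sub]
  · simp only [scF, scW, hm, scProd, scPhase_real_mul ha, Prod.smul_snd, Pi.smul_apply,
      Complex.real_smul]
    push_cast; ring

theorem scF_eq_iff (hd : ∀ j, d j ≠ 0) (x y : Fin n → ℂ) :
    scF κ b d hb x = scF κ b d hb y ↔
      ∃ s : Fin n → Circle, (∀ k, ∏ j with κ j = k, s j ^ d j = 1) ∧ ∀ j, (s j : ℂ) * x j = y j := by
  classical
  constructor
  · intro h
    have hw : ∀ k, scW κ b d hb x k = scW κ b d hb y k := fun k => congrFun (congrArg Prod.snd h) k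
    have hm : ∀ k, scMin κ b hb (fun j => ‖x j‖) k = scMin κ b hb (fun j => ‖y j‖) k := by
      intro k; rw [← scW_norm κ b d hb, ← scW_norm κ b d hb, hw]
    have hdiff : ∀ j, ‖x j‖ - ‖x (b (κ j))‖ = ‖y j‖ - ‖y (b (κ j))‖ := by
      intro j
      by_cases hj : b (κ j) = j
      · rw [hj]; simp
      · exact congrFun (congrArg Prod.fst h) ⟨j, hj⟩
    have hnorm : ∀ j, ‖x j‖ = ‖y j‖ := by
      intro j
      obtain ⟨j1, hj1, h1⟩ := scMin_exists κ b hb (fun j => ‖x j‖) (κ j)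
      obtain ⟨j2, hj2, h2⟩ := scMin_exists κ b hb (fun j => ‖y j‖) (κ j)
      have h3 := scMin_le κ b hb (fun j => ‖x j‖) j2
      have h4 := scMin_le κ b hb (fun j => ‖y j‖) j1
      have e1 := hdiff j1
      have e2 := hdiff j2
      have e := hdiff j
      have e3 := hm (κ j)
      rw [hj1] at e1 h4
      rw [hj2] at e2 h3
      linarith
    -- choose the rotations
    choose ρ hρ using fun (j : Fin n) (c : Circle) => sc_root (d j) (hd j) c
    let s0 : Fin n → Circle := fun j => scPhase (y j) / scPhase (x j)
    have hs0 : ∀ j, (s0 j : ℂ) * x j = y j := by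
      intro j
      conv_lhs => rw [← scPhase_mul (x j)]
      conv_rhs => rw [← scPhase_mul (y j)]
      rw [hnorm j]
      simp only [s0, Circle.coe_div]
      have := Circle.coe_ne_zero (scPhase (x j))
      field_simp
    let P : Fin l → Circle := fun k => ∏ j with κ j = k, s0 j ^ d j
    have hP : ∀ k, scMin κ b hb (fun j => ‖x j‖) k ≠ 0 → P k = 1 := by
      intro k hk
      have h1 := hw k
      rw [scW, scW, ← hm k] at h1
      have h2 : scProd κ d x k = scProd κ d y k := by
        have := mul_left_cancel₀ (by exact_mod_cast hk) h1
        exact Circle.ext this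
      simp only [P, s0, div_zpow, Finset.prod_div_distrib]
      rw [scProd, scProd] at h2
      rw [h2, div_self']
    choose e he1 he2 using scMin_exists κ b hb (fun j => ‖x j‖)
    -- correct at index e k
    let s : Fin n → Circle := fun j =>
      if j = e (κ j) ∧ x j = 0 then s0 j * ρ j (P (κ j))⁻¹ else s0 j
    refine ⟨s, fun k => ?_, fun j => ?_⟩
    · by_cases hk : x (e k) = 0
      · have : ∀ j ∈ Finset.univ.filter (fun j => κ j = k),
            s j ^ d j = s0 j ^ d j * (if j = e k then (P k)⁻¹ else 1) := by
          intro j hj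
          have hj : κ j = k := by simpa using hj
          subst hj
          by_cases hje : j = e (κ j)
          · have hx0 : x j = 0 := by rw [hje]; exact hk
            simp only [s]
            rw [if_pos ⟨hje, hx0⟩, if_pos hje, mul_zpow, hρ]
          · simp only [s]
            rw [if_neg (fun h => hje h.1), if_neg hje, mul_one]
        rw [Finset.prod_congr rfl this, Finset.prod_mul_distrib, Finset.prod_ite_eq',
          if_pos (by simp [he1])]
        exact mul_inv_cancel _
      · rw [← hP k (by rw [he2]; simpa using hk)]
        apply Finset.prod_congr rfl
        intro j hj
        have hj : κ j = k := by simpa using hj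
        subst hj
        simp only [s]
        rw [if_neg]
        rintro ⟨h1, h2⟩
        rw [← h1] at hk
        exact hk h2
    · by_cases hj : j = e (κ j) ∧ x j = 0
      · have hy : y j = 0 := by rw [← norm_eq_zero, ← hnorm, hj.2, norm_zero]
        rw [hj.2, hy, mul_zero]
      · simp only [s]
        rw [if_neg hj, hs0]
  · rintro ⟨s, hs, hxy⟩
    have hnorm : ∀ j, ‖y j‖ = ‖x j‖ := by
      intro j; rw [← hxy j, norm_mul, Circle.norm_coe, one_mul]
    have hw : ∀ k, scW κ b d hb x k = scW κ b d hb y k := by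
      intro k
      rw [scW, scW]
      simp_rw [hnorm]
      by_cases hk : scMin κ b hb (fun j => ‖x j‖) k = 0
      · rw [hk]; simp
      · congr 2
        rw [scProd, scProd]
        have : ∀ j ∈ Finset.univ.filter (fun j => κ j = k),
            scPhase (y j) ^ d j = s j ^ d j * scPhase (x j) ^ d j := by
          intro j hj
          have hj : κ j = k := by simpa using hj
          subst hj
          rw [← hxy j, scPhase_circle_mul, mul_zpow]
          intro h0
          apply hk
          apply le_antisymm _ (scMin_nonneg κ b hb x _)
          have := scMin_le κ b hb (fun j => ‖x j‖) j
          simpa [h0] using this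
        rw [Finset.prod_congr rfl this, Finset.prod_mul_distrib, hs, one_mul]
    unfold scF
    simp_rw [hnorm, hw]

theorem scF_surjective (hd : ∀ j, d j ≠ 0) : Function.Surjective (scF κ b d hb) := by
  classical
  rintro ⟨v, w⟩
  choose ρ hρ using fun (j : Fin n) (c : Circle) => sc_root (d j) (hd j) c
  let v' : Fin n → ℝ := fun j => if h : b (κ j) ≠ j then v ⟨j, h⟩ else 0
  let a : Fin n → ℝ := fun j => v' j - scMin κ b hb v' (κ j) + ‖w (κ j)‖
  have ha : ∀ j, ‖w (κ j)‖ ≤ a j := by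
    intro j
    have := scMin_le κ b hb v' j
    simp only [a]; linarith
  have ha0 : ∀ j, 0 ≤ a j := fun j => (norm_nonneg _).trans (ha j)
  let θ : Fin n → Circle := fun j => if j = b (κ j) then ρ j (scPhase (w (κ j))) else 1
  let x : Fin n → ℂ := fun j => (a j : ℂ) * θ j
  have hx : ∀ j, ‖x j‖ = a j := by
    intro j
    simp only [x]
    rw [norm_mul, Circle.norm_coe, mul_one, Complex.norm_real, Real.norm_eq_abs,
      abs_of_nonneg (ha0 j)]
  have hmin : ∀ k, scMin κ b hb (fun j => ‖x j‖) k = ‖w k‖ := by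
    intro k
    apply scMin_eq
    · rintro j rfl
      rw [hx]; exact ha j
    · obtain ⟨j, rfl, h⟩ := scMin_exists κ b hb v' k
      refine ⟨j, rfl, ?_⟩
      rw [hx]; simp only [a]; rw [h]; ring
  refine ⟨x, ?_⟩
  refine Prod.ext (funext fun j => ?_) (funext fun k => ?_)
  · simp only [scF, hx, a, hb]
    have h1 : v' j = v j := by simp only [v']; rw [dif_pos j.2]
    have h2 : v' (b (κ j)) = 0 := by
      simp only [v']; rw [dif_neg]; simp [hb]
    rw [h1, h2]; ring
  · change scW κ b d hb x k = w k
    rw [scW, hmin]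
    by_cases hk : w k = 0
    · simp [hk]
    · have : scProd κ d x k = scPhase (w k) := by
        rw [scProd]
        have : ∀ j ∈ Finset.univ.filter (fun j => κ j = k),
            scPhase (x j) ^ d j = if j = b k then scPhase (w k) else 1 := by
          intro j hj
          have hj : κ j = k := by simpa using hj
          subst hj
          simp only [x]
          rw [scPhase_eq ((norm_pos_iff.2 hk).trans_le (ha j))]
          simp only [θ]
          split_ifs with h
          · rw [hρ]
          · simp
        rw [Finset.prod_congr rfl this, Finset.prod_ite_eq', if_pos (by simp [hb])]
      rw [this, scPhase_mul]

theorem scE_finrank (hb : ∀ k, κ (b k) = k) : Module.finrank ℝ (ScE κ b) = n + l := by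
  classical
  have h1 : Fintype.card {j : Fin n // b (κ j) = j} = l := by
    have e : {j : Fin n // b (κ j) = j} ≃ Fin l :=
      { toFun := fun j => κ j
        invFun := fun k => ⟨b k, by rw [hb]⟩
        left_inv := fun j => Subtype.ext j.2
        right_inv := fun k => hb k }
    simpa using Fintype.card_congr e
  have h2 := Fintype.card_subtype_compl (fun j : Fin n => b (κ j) = j)
  have h3 := Fintype.card_subtype_le (fun j : Fin n => b (κ j) = j)
  rw [h1] at h2 h3
  rw [Module.finrank_prod, Module.finrank_pi, Module.finrank_pi_fintype]
  simp only [Fintype.card_fin, Complex.finrank_real_complex, Finset.sum_const, Finset.card_univ, smul_eq_mul] at *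
  have h4 : Fintype.card {j : Fin n // b (κ j) ≠ j} = n - l := h2
  omega

end scF

/-- If the columns of `z` generate `ℤ^r` (effective action) and the column
matroid of `z` is a direct sum of circuits (there is a partition of `Fin n` into nonempty
blocks, each indexing a circuit of columns, with `r = n - l`), then the orbit space `X_z`
is homeomorphic to the sphere of dimension `2n - 1 - r`. -/
theorem orbitSpace_homeomorph_sphere_of_sum_of_circuits (n r : ℕ) (hn : 1 ≤ n)
    (z : Fin r → Fin n → ℤ)
    (heff : Submodule.span ℤ (Set.range fun j => fun i => z i j) = ⊤)
    (hsum : IsSumOfCircuits z) :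
    Nonempty (OrbitSpace z ≃ₜ Metric.sphere (0 : EuclideanSpace ℝ (Fin (2 * n - r))) 1) := by
  have hspan := sc_span n r z heff
  obtain ⟨l, κ, b, d, hb, hd, hrl, h1, h2⟩ := sc_algebra n r z hspan hsum
  have himg := sc_image n r l z hspan κ d h1 h2
  have hN : 2 * n - r = n + l := by omega
  rw [hN]
  obtain ⟨e⟩ : Nonempty (ScE κ b ≃L[ℝ] EuclideanSpace ℝ (Fin (n + l))) :=
    FiniteDimensional.nonempty_continuousLinearEquiv_iff_finrank_eq.2
      (by rw [scE_finrank κ b hb]; simp)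
  let F : (Fin n → ℂ) → EuclideanSpace ℝ (Fin (n + l)) := fun x => e (scF κ b d hb x)
  have hFc : Continuous F := e.continuous.comp (scF_continuous κ b d hb)
  have hFs : ∀ {a : ℝ}, 0 < a → ∀ x, F (fun j => (a : ℂ) * x j) = a • F x := by
    intro a ha x
    simp only [F]
    rw [scF_smul κ b d hb ha, map_smul]
  have hFiff : ∀ x y, F x = F y ↔ ∃ t : Fin r → Circle, ∀ j, (weightProd z t j : ℂ) * x j = y j := by
    intro x y
    simp only [F]
    rw [e.injective.eq_iff, scF_eq_iff κ b d hb hd]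
    constructor
    · rintro ⟨s, hs, hxy⟩
      obtain ⟨t, ht⟩ := (himg s).2 hs
      exact ⟨t, fun j => by rw [ht, hxy]⟩
    · rintro ⟨t, ht⟩
      exact ⟨weightProd z t, (himg _).1 ⟨t, fun _ => rfl⟩, ht⟩
  have hFsurj : Function.Surjective F := e.surjective.comp (scF_surjective κ b d hb hd)
  have hF0 : F 0 = 0 := by
    have h := hFs (a := 2) (by norm_num) 0
    have h' : (fun j : Fin n => ((2 : ℝ) : ℂ) * (0 : Fin n → ℂ) j) = 0 := by ext; simp
    rw [h', two_smul] at h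
    simpa using h
  have hnormF : ∀ (x y : EuclideanSpace ℂ (Fin n)), F x = F y → ‖x‖ = ‖y‖ := by
    intro x y h
    obtain ⟨t, ht⟩ := (hFiff _ _).1 h
    rw [EuclideanSpace.norm_eq, EuclideanSpace.norm_eq]
    congr 1
    apply Finset.sum_congr rfl
    intro j _
    rw [← ht j, norm_mul, Circle.norm_coe, one_mul]
  have hFne : ∀ x : EuclideanSpace ℂ (Fin n), x ≠ 0 → F x ≠ 0 := by
    intro x hx h
    apply hx
    have := hnormF x 0 (by rw [h]; exact hF0.symm)
    simpa using this
  have hSne : ∀ x : Sph n, F x.1 ≠ 0 := by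
    intro x
    apply hFne
    intro h
    have := x.2
    rw [mem_sphere_zero_iff_norm, h] at this
    simp at this
  have hsmul : ∀ {a : ℝ}, 0 < a → ∀ x : EuclideanSpace ℂ (Fin n), F (((a : ℂ) • x : EuclideanSpace ℂ (Fin n)) : EuclideanSpace ℂ (Fin n)).ofLp = a • F x := by
    intro a ha x
    exact hFs ha x
  let Φ : Sph n → Metric.sphere (0 : EuclideanSpace ℝ (Fin (n + l))) 1 := fun x =>
    ⟨(‖F x.1‖)⁻¹ • F x.1, by
      rw [mem_sphere_zero_iff_norm, norm_smul, norm_inv, norm_norm,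
        inv_mul_cancel₀ (norm_ne_zero_iff.2 (hSne x))]⟩
  have hFS : Continuous fun x : Sph n => F x.1 :=
    hFc.comp ((PiLp.continuous_ofLp 2 _).comp continuous_subtype_val)
  have hΦc : Continuous Φ := by
    apply Continuous.subtype_mk
    exact (hFS.norm.inv₀ fun x => norm_ne_zero_iff.2 (hSne x)).smul hFS
  have hΦiff : ∀ x y : Sph n, Φ x = Φ y ↔ (orbitSetoid z) x y := by
    intro x y
    change _ ↔ ∃ t : Fin r → Circle, _
    rw [← hFiff]
    constructor
    · intro h
      have h' : (‖F x.1‖)⁻¹ • F x.1 = (‖F y.1‖)⁻¹ • F y.1 := congrArg Subtype.val h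
      have px := norm_pos_iff.2 (hSne x)
      have py := norm_pos_iff.2 (hSne y)
      rw [← hsmul (inv_pos.2 px), ← hsmul (inv_pos.2 py)] at h'
      have h3 := hnormF _ _ h'
      rw [norm_smul, norm_smul, mem_sphere_zero_iff_norm.1 x.2, mem_sphere_zero_iff_norm.1 y.2,
        Complex.norm_real, Complex.norm_real, mul_one, mul_one, norm_inv, norm_inv, norm_norm,
        norm_norm, inv_inj] at h3
      rw [hsmul (inv_pos.2 px), hsmul (inv_pos.2 py), h3] at h'
      exact smul_right_injective _ (inv_pos.2 py).ne' h'
    · intro h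
      apply Subtype.ext
      simp only [Φ]
      rw [h]
  have hΦs : Function.Surjective Φ := by
    intro y
    obtain ⟨x, hx⟩ := hFsurj y.1
    let x' : EuclideanSpace ℂ (Fin n) := WithLp.toLp 2 x
    have hx' : F x' = y.1 := hx
    have hy := mem_sphere_zero_iff_norm.1 y.2
    have hx0 : x' ≠ 0 := by
      intro h
      rw [h] at hx'
      have h0 : F ((0 : EuclideanSpace ℂ (Fin n)) : Fin n → ℂ) = 0 := hF0
      rw [← hx', h0] at hy
      simp at hy
    have hp := norm_pos_iff.2 hx0
    refine ⟨⟨((‖x'‖⁻¹ : ℝ) : ℂ) • x', ?_⟩, ?_⟩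
    · rw [mem_sphere_zero_iff_norm, norm_smul, Complex.norm_real, norm_inv, norm_norm,
        inv_mul_cancel₀ hp.ne']
    · apply Subtype.ext
      simp only [Φ]
      rw [hsmul (inv_pos.2 hp), hx', norm_smul, hy, norm_inv, norm_norm, mul_one, inv_inv,
        smul_smul, mul_inv_cancel₀ hp.ne', one_smul]
  let Ψ : OrbitSpace z → Metric.sphere (0 : EuclideanSpace ℝ (Fin (n + l))) 1 :=
    Quotient.lift Φ fun x y h => (hΦiff x y).2 h
  have hΨc : Continuous Ψ := hΦc.quotient_lift _
  have hΨb : Function.Bijective Ψ := by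
    constructor
    · intro p q
      induction p using Quotient.inductionOn with | _ x
      induction q using Quotient.inductionOn with | _ y
      intro h
      exact Quotient.sound ((hΦiff x y).1 h)
    · intro y
      obtain ⟨x, hx⟩ := hΦs y
      exact ⟨Quotient.mk _ x, hx⟩
  have : CompactSpace (OrbitSpace z) := Quotient.compactSpace
  exact ⟨Continuous.homeoOfEquivCompactToT2 (f := Equiv.ofBijective Ψ hΨb) hΨc⟩
end
end
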